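/- arXiv:1309.3530 — 7 statements merged into one kernel-verified Lean document; each statement's English description precedes it below -/
import Mathlib

section
/- Let q be any prime power and z ∈ F_q with z ≠ 0 such that the quadratic x² + x − z has two distinct roots in F_q. Then ∑_{0 ≤ l ≤ q/2} (l+1)·binom(−l, l)·z^l = (1 + 3z)/(1 + 4z). -/
/-- The scaled coefficients of `(1 + X) ^ (-1/2)` are the signed central binomial coefficients. -/
theorem four_pow_mul_choose_neg_half (l : ℕ) :
    4 ^ l * Ring.choose (-1 / 2 : ℚ) l = (-1) ^ l * (l.centralBinom : ℚ) := by
  induction l with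
  | zero => simp
  | succ l ih =>
    have h2 : ((l : ℚ) + 1) * ((l + 1).centralBinom : ℚ)
        = 2 * (2 * l + 1) * (l.centralBinom : ℚ) := by
      exact_mod_cast Nat.succ_mul_centralBinom_succ l
    have h3 : ((l : ℚ) + 1) * Ring.choose (-1 / 2 : ℚ) (l + 1)
        = (-1 / 2 - l) * Ring.choose (-1 / 2 : ℚ) l := by
      rw [Ring.choose_eq_smul, Ring.choose_eq_smul, descPochhammer_succ_right, Nat.factorial_succ]
      have : (l.factorial : ℚ) ≠ 0 := by positivity
      have : (l + 1 : ℚ) ≠ 0 := by positivity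
      simp [Polynomial.smeval_mul, Polynomial.smeval_sub, Polynomial.smeval_natCast]
      field_simp
    have h4 : (l + 1 : ℚ) ≠ 0 := by positivity
    apply mul_left_cancel₀ h4
    linear_combination 4 ^ (l + 1) * h3 + (-1 / 2 - l) * 4 * ih - (-1) ^ (l + 1) * h2

theorem two_mul_choose_neg_self {l : ℕ} (hl : l ≠ 0) :
    2 * Ring.choose (-(l : ℤ)) l = (-1) ^ l * (l.centralBinom : ℤ) := by
  obtain ⟨l, rfl⟩ := Nat.exists_eq_succ_of_ne_zero hl
  have h : (l + 1).centralBinom = 2 * (2 * l + 1).choose (l + 1) := by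
    rw [Nat.centralBinom_eq_two_mul_choose, show 2 * (l + 1) = 2 * l + 1 + 1 by ring,
      Nat.choose_succ_succ' (2 * l + 1) l, Nat.choose_symm_half]
    ring
  rw [Ring.choose_neg, Nat.succ_eq_add_one, h,
    show (((l + 1 : ℕ) : ℤ) + (l + 1 : ℕ) - 1) = ((2 * l + 1 : ℕ) : ℤ) by push_cast; ring,
    Ring.choose_natCast, Int.negOnePow_def, Units.smul_def, zpow_natCast]
  push_cast
  simp only [smul_eq_mul]
  ring

/-- The generating function of `binom(-l, l)`. -/
noncomputable def chooseNegSelfSeries : PowerSeries ℤ :=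
  PowerSeries.mk fun l => Ring.choose (-(l : ℤ)) l

theorem chooseNegSelfSeries_quadratic :
    (chooseNegSelfSeries ^ 2 - chooseNegSelfSeries) * (1 + 4 * PowerSeries.X) = -PowerSeries.X := by
  set B : PowerSeries ℚ := PowerSeries.binomialSeries ℚ (-1 / 2 : ℚ) with hB
  have hB2 : B * B * (1 + PowerSeries.X) = 1 := by
    have h1 : (1 + PowerSeries.X : PowerSeries ℚ)
        = PowerSeries.binomialSeries ℚ ((1 : ℕ) : ℚ) := by
      rw [PowerSeries.binomialSeries_nat, pow_one]
    rw [h1, hB, ← PowerSeries.binomialSeries_add, ← PowerSeries.binomialSeries_add,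
      ← PowerSeries.binomialSeries_zero (R := ℚ)]
    norm_num
  have hX : PowerSeries.rescale (4 : ℚ) PowerSeries.X = 4 * PowerSeries.X := by
    rw [PowerSeries.rescale_X, map_ofNat]
  have hR := congrArg (PowerSeries.rescale (4 : ℚ)) hB2
  simp only [map_mul, map_add, map_one, hX] at hR
  have hmap : 2 * PowerSeries.map (Int.castRingHom ℚ) chooseNegSelfSeries
      = 1 + PowerSeries.rescale (4 : ℚ) B := by
    have h2 : (2 : PowerSeries ℚ) = PowerSeries.C 2 := (map_ofNat _ 2).symm
    ext l
    rw [h2, PowerSeries.coeff_C_mul, PowerSeries.coeff_map, map_add, PowerSeries.coeff_rescale,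
      hB, PowerSeries.binomialSeries_coeff, smul_eq_mul, mul_one, four_pow_mul_choose_neg_half,
      chooseNegSelfSeries, PowerSeries.coeff_mk, PowerSeries.coeff_one]
    split_ifs with hl
    · subst hl
      norm_num
    · have := two_mul_choose_neg_self hl
      rw [zero_add]
      simp only [eq_intCast]
      exact_mod_cast this
  apply PowerSeries.map_injective (Int.castRingHom ℚ) Int.cast_injective
  have h4 : PowerSeries.map (Int.castRingHom ℚ) 4 = 4 := map_ofNat _ 4
  simp only [map_mul, map_sub, map_add, map_neg, map_one, map_pow, PowerSeries.map_X, h4]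
  have h40 : (4 : PowerSeries ℚ) ≠ 0 := by
    rw [← map_ofNat (PowerSeries.C (R := ℚ)) 4, map_ne_zero_iff _ PowerSeries.C_injective]
    norm_num
  apply mul_left_cancel₀ h40
  set H := PowerSeries.map (Int.castRingHom ℚ) chooseNegSelfSeries
  set R := PowerSeries.rescale (4 : ℚ) B
  linear_combination (1 + 4 * PowerSeries.X) * (2 * H - 1 + R) * hmap + hR

open Polynomial in
/-- A polynomial solving the quadratic equation of `chooseNegSelfSeries` up to an error `X ^ q` has
the same coefficients as that series below degree `q`. -/
theorem coeff_eq_choose_neg_self {R : Type*} [CommRing R] {g : R[X]} {q l : ℕ}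
    (h0 : g.coeff 0 = 1) (hg : (g ^ 2 - g) * (1 + 4 * X) = X ^ q - X) (hl : l < q) :
    g.coeff l = ((Ring.choose (-(l : ℤ)) l : ℤ) : R) := by
  set H := PowerSeries.map (Int.castRingHom R) chooseNegSelfSeries with hH
  have hHq : (H ^ 2 - H) * (1 + 4 * PowerSeries.X) = -PowerSeries.X := by
    have := congrArg (PowerSeries.map (Int.castRingHom R)) chooseNegSelfSeries_quadratic
    have h4 : PowerSeries.map (Int.castRingHom R) 4 = 4 := map_ofNat _ 4
    simpa only [map_mul, map_sub, map_add, map_neg, map_one, map_pow, PowerSeries.map_X, h4]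
      using this
  set G : PowerSeries R := (g : PowerSeries R) with hG
  have hGq : (G ^ 2 - G) * (1 + 4 * PowerSeries.X) = PowerSeries.X ^ q - PowerSeries.X := by
    have := congrArg (Polynomial.coeToPowerSeries.ringHom (R := R)) hg
    have h4 : Polynomial.coeToPowerSeries.ringHom (R := R) 4 = 4 := map_ofNat _ 4
    simpa only [map_mul, map_sub, map_add, map_neg, map_one, map_pow, h4,
      Polynomial.coeToPowerSeries.ringHom_apply, Polynomial.coe_X] using this
  have hfac : (G - H) * ((G + H - 1) * (1 + 4 * PowerSeries.X)) = PowerSeries.X ^ q := by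
    linear_combination hGq - hHq
  have hunit : IsUnit ((G + H - 1) * (1 + 4 * PowerSeries.X)) := by
    rw [PowerSeries.isUnit_iff_constantCoeff]
    have hG0 : PowerSeries.constantCoeff G = 1 := by
      rw [← PowerSeries.coeff_zero_eq_constantCoeff_apply, hG, Polynomial.coeff_coe, h0]
    have hH0 : PowerSeries.constantCoeff H = 1 := by
      rw [← PowerSeries.coeff_zero_eq_constantCoeff_apply, hH, PowerSeries.coeff_map,
        chooseNegSelfSeries, PowerSeries.coeff_mk]
      simp
    simp [hG0, hH0]
  have hdvd : PowerSeries.X ^ q ∣ G - H := by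
    rw [← hunit.dvd_mul_right, hfac]
  have := PowerSeries.X_pow_dvd_iff.mp hdvd l hl
  rw [map_sub, sub_eq_zero, hG, Polynomial.coeff_coe, hH, PowerSeries.coeff_map,
    chooseNegSelfSeries, PowerSeries.coeff_mk] at this
  simpa using this

open Polynomial in
theorem sum_range_succ_mul_coeff_mul_pow {R : Type*} [CommRing R] {g : R[X]} {n : ℕ}
    (hn : g.natDegree ≤ n) (z : R) :
    ∑ l ∈ Finset.range (n + 1), ((l : R) + 1) * g.coeff l * z ^ l
      = g.eval z + z * g.derivative.eval z := by
  have hd : (X * g).derivative.natDegree < n + 1 := by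
    have h1 := natDegree_derivative_le (X * g)
    have h2 := (natDegree_mul_le (p := X) (q := g)).trans (Nat.add_le_add_right natDegree_X_le _)
    omega
  have h := eval_eq_sum_range' hd z
  simp only [coeff_derivative, coeff_X_mul] at h
  rw [derivative_mul, derivative_X, one_mul, eval_add, eval_mul, eval_X] at h
  rw [h]
  exact Finset.sum_congr rfl fun l _ => by ring

open Polynomial in
theorem exists_quadratic_solution_of_char_two {F : Type*} [Field F] [Fintype F] [CharP F 2]
    {z r : F} (hr : r ^ 2 + r = z) :
    ∃ g : F[X], g.coeff 0 = 1 ∧ (g ^ 2 - g) * (1 + 4 * X) = X ^ Fintype.card F - X ∧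
      g.natDegree ≤ Fintype.card F / 2 ∧ g.eval z = 1 := by
  obtain ⟨⟨k, hk0⟩, -, hk⟩ := FiniteField.card F 2
  simp only [PNat.mk_coe] at hk
  have h2 : (2 : F[X]) = 0 := CharP.cast_eq_zero F[X] 2
  have hsq : ∀ k, (∑ i ∈ Finset.range k, (X : F[X]) ^ 2 ^ i) ^ 2
      - ∑ i ∈ Finset.range k, (X : F[X]) ^ 2 ^ i = X ^ 2 ^ k - X := by
    intro k
    rw [sum_pow_char 2, ← Finset.sum_sub_distrib]
    simp only [← pow_mul, ← pow_succ]
    rw [Finset.sum_range_sub (fun i => (X : F[X]) ^ 2 ^ i)]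
    simp
  have htr : ∀ k, ∑ i ∈ Finset.range k, z ^ 2 ^ i = r ^ 2 ^ k - r := by
    intro k
    have : ∀ i, z ^ 2 ^ i = r ^ 2 ^ (i + 1) - r ^ 2 ^ i := by
      intro i
      rw [← hr, add_pow_char_pow, ← pow_mul, ← pow_succ', CharTwo.sub_eq_add]
    simp only [this]
    rw [Finset.sum_range_sub (fun i => r ^ 2 ^ i)]
    simp
  refine ⟨1 + ∑ i ∈ Finset.range k, X ^ 2 ^ i, ?_, ?_, ?_, ?_⟩
  · simp [coeff_zero_eq_eval_zero, eval_finsetSum]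
  · rw [hk, ← hsq]
    linear_combination (2 * X * ((1 + ∑ i ∈ Finset.range k, X ^ 2 ^ i) ^ 2
      - (1 + ∑ i ∈ Finset.range k, X ^ 2 ^ i)) + ∑ i ∈ Finset.range k, X ^ 2 ^ i) * h2
  · refine (natDegree_add_le _ _).trans (max_le (by simp) ?_)
    refine natDegree_sum_le_of_forall_le _ _ fun i hi => ?_
    rw [natDegree_X_pow, hk, Nat.le_div_iff_mul_le two_pos, ← pow_succ]
    exact Nat.pow_le_pow_right two_pos (Finset.mem_range.mp hi)
  · simp only [eval_add, eval_one, eval_finsetSum, eval_pow, eval_X]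
    rw [htr, ← hk, FiniteField.pow_card, sub_self, add_zero]

open Polynomial in
theorem exists_quadratic_solution_of_two_ne_zero {F : Type*} [Field F] [Fintype F]
    (h2 : (2 : F) ≠ 0) {z r : F} (hr : r ^ 2 + r = z) (hr0 : 1 + 2 * r ≠ 0) :
    ∃ g : F[X], g.coeff 0 = 1 ∧ (g ^ 2 - g) * (1 + 4 * X) = X ^ Fintype.card F - X ∧
      g.natDegree ≤ Fintype.card F / 2 ∧ g.eval z = 1 := by
  have hodd : Fintype.card F % 2 = 1 := by
    refine FiniteField.odd_card_of_char_ne_two fun h => h2 ?_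
    exact_mod_cast (ringChar.spec F 2).mpr (by rw [h])
  set n := Fintype.card F / 2 with hn
  have hcard : Fintype.card F = 2 * n + 1 := by omega
  have hC : (2 * C (1 / 2 : F) : F[X]) = 1 := by
    rw [show (2 : F[X]) = C 2 from (map_ofNat C 2).symm, ← C_mul, mul_one_div_cancel h2, C_1]
  have hfrob : ((1 + 4 * X : F[X]) ^ n) ^ 2 * (1 + 4 * X) = 1 + 4 * X ^ Fintype.card F := by
    rw [← pow_mul, mul_comm n 2, ← pow_succ, ← hcard, ← FiniteField.expand_card, map_add, map_mul, map_one,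
      map_ofNat, expand_X]
  refine ⟨C (1 / 2) * (1 + (1 + 4 * X) ^ n), ?_, ?_, ?_, ?_⟩
  · rw [coeff_zero_eq_eval_zero]
    simp only [eval_mul, eval_C, eval_add, eval_one, eval_pow, eval_X, eval_ofNat, mul_zero,
      add_zero, one_pow]
    field_simp
    norm_num
  · set c := C (1 / 2 : F)
    set P := (1 + 4 * X : F[X]) ^ n
    have h4 : (4 : F[X]) ≠ 0 := by
      rw [← map_ofNat C 4, Ne, C_eq_zero, show (4 : F) = 2 * 2 by norm_num]
      exact mul_ne_zero h2 h2
    apply mul_left_cancel₀ h4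
    linear_combination hfrob
      + (1 + 4 * X) * ((2 * c + 1) * (1 + P) ^ 2 - 2 * (1 + P)) * hC
  · refine (natDegree_C_mul_le _ _).trans ((natDegree_add_le _ _).trans (max_le (by simp) ?_))
    refine natDegree_pow_le.trans ?_
    have : (1 + 4 * X : F[X]).natDegree ≤ 1 := by
      rw [show (1 + 4 * X : F[X]) = C 4 * X + C 1 by
        rw [map_ofNat, C_1, add_comm]]
      exact natDegree_linear_le
    nlinarith
  · have hz : (1 + 4 * z) ^ n = 1 := by
      rw [show 1 + 4 * z = (1 + 2 * r) ^ 2 by rw [← hr]; ring, ← pow_mul,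
        show 2 * n = Fintype.card F - 1 by omega, FiniteField.pow_card_sub_one_eq_one _ hr0]
    simp only [eval_mul, eval_C, eval_add, eval_one, eval_pow, eval_X, eval_ofNat, hz]
    field_simp
    norm_num

/-- **Lemma 3.3** (Hou). Let `z ∈ F_q^*` be such that `x² + x − z` has two distinct
roots in `F_q`. Then `∑_{0 ≤ l ≤ ⌊q/2⌋} (l+1)·binom(−l, l)·z^l = (1+3z)/(1+4z)`. -/
theorem binom_sum_l_add_one_neg_l_l
    (q : ℕ)
    (F : Type*) [Field F] [Fintype F]
    (hF : Fintype.card F = q)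
    (z : F) (hz : z ≠ 0)
    (hroots : ∃ r s : F, r ≠ s ∧ r ^ 2 + r - z = 0 ∧ s ^ 2 + s - z = 0) :
    ∑ l ∈ Finset.range (q / 2 + 1),
      ((l : F) + 1) * ((Ring.choose (-(l : ℤ)) l : ℤ) : F) * z ^ l
      = (1 + 3 * z) / (1 + 4 * z) := by
  subst hF
  obtain ⟨r, s, hrs, hr, hs⟩ := hroots
  have hsum : r + s + 1 = 0 := by
    apply mul_left_cancel₀ (sub_ne_zero.mpr hrs)
    linear_combination hr - hs
  have hr0 : 1 + 2 * r ≠ 0 := fun h => hrs (by linear_combination h - hsum)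
  have hz4 : 1 + 4 * z = (1 + 2 * r) ^ 2 := by linear_combination -4 * hr
  have hne : 1 + 4 * z ≠ 0 := hz4 ▸ pow_ne_zero 2 hr0
  have hrz : r ^ 2 + r = z := by linear_combination hr
  obtain ⟨g, h0, hg, hdeg, hgz⟩ : ∃ g : Polynomial F, g.coeff 0 = 1 ∧
      (g ^ 2 - g) * (1 + 4 * Polynomial.X) = Polynomial.X ^ Fintype.card F - Polynomial.X ∧
      g.natDegree ≤ Fintype.card F / 2 ∧ g.eval z = 1 := by
    by_cases h2 : (2 : F) = 0
    · have : CharP F 2 := CharTwo.of_one_ne_zero_of_two_eq_zero one_ne_zero h2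
      exact exists_quadratic_solution_of_char_two hrz
    · exact exists_quadratic_solution_of_two_ne_zero h2 hrz hr0
  have hder : g.derivative.eval z * (1 + 4 * z) = -1 := by
    have h := congrArg (fun p => p.derivative.eval z) hg
    simp [hgz, Polynomial.derivative_pow] at h
    linear_combination h
  have hlt : Fintype.card F / 2 < Fintype.card F := Nat.div_lt_self Fintype.card_pos one_lt_two
  rw [Finset.sum_congr rfl fun l hl => by
      rw [← coeff_eq_choose_neg_self h0 hg ((Finset.mem_range_succ_iff.mp hl).trans_lt hlt)],
    sum_range_succ_mul_coeff_mul_pow hdeg, hgz, eq_div_iff hne]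
  linear_combination z * hder
end

section
/- Let q be any prime power and z ∈ F_q with z ≠ 0 such that the quadratic x² + x − z has two distinct roots in F_q. Then ∑_{0 ≤ l ≤ (q−1)/2} binom(−l, l+1)·z^l = 1 and ∑_{0 ≤ l ≤ (q−1)/2} (l+1)·binom(−l, l+1)·z^l = 2z/(1 + 4z). -/
section

open Finset

variable {F : Type*} [Field F] [Fintype F]

theorem FiniteField.cast_choose_eq_zero {n k : ℕ} (hn : Fintype.card F ≤ n)
    (hnk : n < Fintype.card F + k) (hk : k < Fintype.card F) : (n.choose k : F) = 0 := by
  obtain ⟨p, hp⟩ := CharP.exists F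
  obtain ⟨e, hpp, hq⟩ := FiniteField.card F p
  obtain ⟨j, rfl⟩ := Nat.exists_eq_add_of_le hn
  rw [CharP.cast_eq_zero_iff F p, Nat.add_choose_eq]
  refine Finset.dvd_sum fun ij hij => ?_
  rw [HasAntidiagonal.mem_antidiagonal] at hij
  by_cases h0 : ij.1 = 0
  · rw [Nat.choose_eq_zero_of_lt (show j < ij.2 by omega), mul_zero]
    exact dvd_zero p
  · rw [hq]
    exact (hpp.dvd_choose_pow h0 (by omega)).mul_right _

theorem FiniteField.sum_units_pow_mul_one_add_pow [DecidableEq F] {e n : ℕ}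
    (he : e ≤ Fintype.card F - 1) (hn : e + n < 2 * (Fintype.card F - 1)) :
    ∑ x : Fˣ, (x : F) ^ e * (1 + x) ^ n =
      -(n.choose (Fintype.card F - 1 - e) : F) - if e = 0 then 1 else 0 := by
  set m := Fintype.card F - 1 with hm
  have hm0 : 0 < m := by omega
  have expand (x : Fˣ) : (x : F) ^ e * (1 + x) ^ n =
      ∑ k ∈ range (n + 1), (n.choose k : F) * (x : F) ^ (e + k) := by
    rw [add_comm, add_pow, mul_sum]
    refine sum_congr rfl fun k _ => ?_
    rw [one_pow, pow_add]
    ring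
  have term (k : ℕ) (hk : k ∈ range (n + 1)) :
      ∑ x : Fˣ, (n.choose k : F) * (x : F) ^ (e + k) =
        -(if k = m - e then (n.choose k : F) else 0) -
          if k = 0 then (if e = 0 then 1 else 0) else 0 := by
    rw [mem_range] at hk
    rw [← mul_sum, FiniteField.sum_pow_units, ← hm]
    have hdvd : m ∣ e + k ↔ (k = m - e ∨ (k = 0 ∧ e = 0)) := by
      constructor
      · rintro ⟨c, hc⟩
        have hc2 : c < 2 := by
          by_contra! h
          have := Nat.mul_le_mul_left m h
          omega
        interval_cases c <;> omega
      · rintro (h | ⟨rfl, rfl⟩)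
        · rw [h, Nat.add_sub_cancel' he]
        · simp
    by_cases h1 : k = m - e
    · have : ¬ (k = 0 ∧ e = 0) := by omega
      rw [if_pos (hdvd.2 (Or.inl h1)), if_pos h1]
      split_ifs <;> first | (exfalso; tauto) | ring
    · by_cases h2 : k = 0 ∧ e = 0
      · rw [if_pos (hdvd.2 (Or.inr h2)), if_neg h1, if_pos h2.1, if_pos h2.2, h2.1]
        simp
      · rw [if_neg (by tauto), if_neg h1]
        split_ifs <;> first | (exfalso; tauto) | ring
  simp_rw [expand]
  rw [sum_comm, sum_congr rfl term, sum_sub_distrib, sum_neg_distrib, sum_ite_eq', sum_ite_eq']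
  congr 1
  · split_ifs with h
    · rfl
    · rw [Nat.choose_eq_zero_of_lt (by rw [mem_range] at h; omega)]
      simp
  · simp

theorem FiniteField.geom_sum_card_sub_one [DecidableEq F] (y : F) :
    ∑ l ∈ range (Fintype.card F - 1), y ^ l = if y = 0 then 1 else if y = 1 then -1 else 0 := by
  have hq : 1 < Fintype.card F := Fintype.one_lt_card
  split_ifs with h0 h1
  · rw [h0, zero_geom_sum, if_neg (by omega)]
  · simp [h1, Nat.cast_sub hq.le]
  · have := mul_geom_sum y (Fintype.card F - 1)
    rw [FiniteField.pow_card_sub_one_eq_one y h0, sub_self] at this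
    exact (mul_eq_zero.1 this).resolve_left (sub_ne_zero.2 h1)

theorem FiniteField.sum_units_mul_geom_sum [DecidableEq F] {r s : F} (hr : r ≠ 0) (hs : s ≠ 0)
    (hrs : r ≠ s) (hadd : r + s = -1) (f : F → F) :
    ∑ x : Fˣ, f x * ∑ l ∈ range (Fintype.card F - 1), (r * s * (1 + x) ^ 2 / x) ^ l =
      f (-1) - f (r / s) - f (s / r) := by
  have hs' : s = -1 - r := by linear_combination hadd
  let c : Fˣ := Units.mk0 r hr / Units.mk0 s hs
  let d : Fˣ := Units.mk0 s hs / Units.mk0 r hr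
  have hc : (c : F) = r / s := by simp [c]
  have hd : (d : F) = s / r := by simp [d]
  have hcd : c ≠ d := by
    intro h
    have h' : r / s = s / r := by rw [← hc, ← hd, h]
    rw [div_eq_div_iff hs hr] at h'
    have : (r - s) * (r + s) = 0 := by linear_combination h'
    rw [hadd] at this
    exact hrs (by linear_combination -this)
  have key (x : Fˣ) : f x * ∑ l ∈ range (Fintype.card F - 1), (r * s * (1 + x) ^ 2 / x) ^ l =
      (if x = -1 then f x else 0) - (if x = c then f x else 0) - (if x = d then f x else 0) := by
    have hx : (x : F) ≠ 0 := x.ne_zero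
    have hzero : r * s * (1 + (x : F)) ^ 2 / x = 0 ↔ x = -1 := by
      rw [div_eq_zero_iff, Units.ext_iff]
      simp only [hx, hr, hs, mul_eq_zero, or_false, false_or, ne_eq, OfNat.ofNat_ne_zero,
        not_false_eq_true, pow_eq_zero_iff, Units.val_neg, Units.val_one]
      constructor <;> intro h <;> linear_combination h
    have hone : r * s * (1 + (x : F)) ^ 2 / x = 1 ↔ (x = c ∨ x = d) := by
      rw [div_eq_one_iff_eq hx, Units.ext_iff, Units.ext_iff, hc, hd, eq_div_iff hs,
        eq_div_iff hr, ← sub_eq_zero, ← sub_eq_zero (a := (x : F) * s),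
        ← sub_eq_zero (a := (x : F) * r), ← mul_eq_zero]
      have : r * s * (1 + (x : F)) ^ 2 - x = (x * s - r) * (x * r - s) := by
        rw [hs']; ring
      rw [this]
    rw [FiniteField.geom_sum_card_sub_one]
    by_cases h0 : x = -1
    · have hn : ¬ (x = c ∨ x = d) := by
        rw [← hone, hzero.2 h0]
        exact zero_ne_one
      rw [if_pos (hzero.2 h0), if_pos h0, if_neg (by tauto), if_neg (by tauto)]
      ring
    · rw [if_neg (by tauto), if_neg h0]
      by_cases h1 : x = c
      · rw [if_pos (by tauto), if_pos h1, if_neg (by rw [h1]; exact hcd)]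
        ring
      · by_cases h2 : x = d
        · rw [if_pos (by tauto), if_neg h1, if_pos h2]
          ring
        · rw [if_neg (by tauto), if_neg h1, if_neg h2]
          ring
  simp_rw [key]
  rw [sum_sub_distrib, sum_sub_distrib, sum_ite_eq', sum_ite_eq', sum_ite_eq']
  simp [hc, hd]

theorem FiniteField.sum_choose_mul_pow_truncate {k : ℕ → ℕ} (hk : ∀ l, l ≤ k l)
    (hk' : ∀ l, k l ≤ l + 1) (hq : 3 ≤ Fintype.card F) (w : F) :
    ∑ l ∈ range ((Fintype.card F - 1) / 2 + 1), ((2 * l).choose (k l) : F) * w ^ l =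
      ∑ l ∈ range (Fintype.card F - 1), ((2 * l).choose (k l) : F) * w ^ l := by
  refine sum_subset (range_subset_range.2 (by omega)) fun l hl hl' => ?_
  rw [mem_range] at hl hl'
  have := hk l
  have := hk' l
  rw [FiniteField.cast_choose_eq_zero (by omega) (by omega) (by omega), zero_mul]

theorem FiniteField.sum_centralBinom_mul_pow {r s : F} (hr : r ≠ 0) (hs : s ≠ 0)
    (hrs : r ≠ s) (hadd : r + s = -1) (hq : 3 ≤ Fintype.card F) :
    ∑ l ∈ range ((Fintype.card F - 1) / 2 + 1), (l.centralBinom : F) * (r * s) ^ l = 1 := by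
  classical
  simp_rw [Nat.centralBinom_eq_two_mul_choose]
  rw [FiniteField.sum_choose_mul_pow_truncate (k := fun l => l) (fun _ => le_rfl)
    (fun l => l.le_succ) hq]
  have h := FiniteField.sum_units_mul_geom_sum hr hs hrs hadd fun _ => 1
  simp_rw [mul_sum] at h
  rw [sum_comm] at h
  have term (l : ℕ) (hl : l ∈ range (Fintype.card F - 1)) :
      ∑ x : Fˣ, 1 * (r * s * (1 + (x : F)) ^ 2 / x) ^ l =
        -(((2 * l).choose l : F) * (r * s) ^ l) := by
    rw [mem_range] at hl
    have hx (x : Fˣ) : 1 * (r * s * (1 + (x : F)) ^ 2 / x) ^ l =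
        (r * s) ^ l * ((x : F) ^ (Fintype.card F - 1 - l) * (1 + x) ^ (2 * l)) := by
      rw [pow_sub₀ _ x.ne_zero hl.le, FiniteField.pow_card_sub_one_eq_one _ x.ne_zero, pow_mul,
        div_pow, mul_pow]
      ring
    simp_rw [hx]
    rw [← mul_sum, FiniteField.sum_units_pow_mul_one_add_pow (by omega) (by omega),
      if_neg (by omega), Nat.sub_sub_self hl.le]
    ring
  rw [sum_congr rfl term, sum_neg_distrib] at h
  linear_combination -h

theorem FiniteField.sum_choose_succ_mul_pow {r s : F} (hr : r ≠ 0) (hs : s ≠ 0)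
    (hrs : r ≠ s) (hadd : r + s = -1) (hq : 3 ≤ Fintype.card F) :
    ∑ l ∈ range ((Fintype.card F - 1) / 2 + 1),
      ((2 * l).choose (l + 1) : F) * (r * s) ^ l = -1 := by
  classical
  rw [FiniteField.sum_choose_mul_pow_truncate (k := fun l => l + 1) (fun l => l.le_succ)
    (fun _ => le_rfl) hq]
  have h := FiniteField.sum_units_mul_geom_sum hr hs hrs hadd fun x => x⁻¹
  simp_rw [mul_sum] at h
  rw [sum_comm] at h
  have term (l : ℕ) (hl : l ∈ range (Fintype.card F - 1)) :
      ∑ x : Fˣ, (x : F)⁻¹ * (r * s * (1 + (x : F)) ^ 2 / x) ^ l =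
        -(((2 * l).choose (l + 1) : F) * (r * s) ^ l) -
          if l = Fintype.card F - 2 then (r * s) ^ l else 0 := by
    rw [mem_range] at hl
    have hx (x : Fˣ) : (x : F)⁻¹ * (r * s * (1 + (x : F)) ^ 2 / x) ^ l =
        (r * s) ^ l * ((x : F) ^ (Fintype.card F - 1 - (l + 1)) * (1 + x) ^ (2 * l)) := by
      rw [pow_sub₀ _ x.ne_zero hl, FiniteField.pow_card_sub_one_eq_one _ x.ne_zero, pow_mul,
        div_pow, mul_pow, pow_succ (x : F), mul_inv]
      ring
    simp_rw [hx]
    rw [← mul_sum, FiniteField.sum_units_pow_mul_one_add_pow (by omega) (by omega),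
      Nat.sub_sub_self hl]
    by_cases h2 : l = Fintype.card F - 2
    · rw [if_pos h2, if_pos (by omega)]
      ring
    · rw [if_neg h2, if_neg (by omega)]
      ring
  rw [sum_congr rfl term, sum_sub_distrib, sum_neg_distrib, sum_ite_eq',
    if_pos (mem_range.2 (by omega)), show Fintype.card F - 2 = Fintype.card F - 1 - 1 by omega,
    pow_sub₀ _ (mul_ne_zero hr hs) (by omega),
    FiniteField.pow_card_sub_one_eq_one _ (mul_ne_zero hr hs)] at h
  have hw : (r / s)⁻¹ + (s / r)⁻¹ = (r * s)⁻¹ - 2 := by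
    field_simp
    linear_combination (r + s - 1) * hadd
  rw [inv_neg, inv_one, pow_one] at h
  linear_combination -h + hw

theorem sum_mul_centralBinom_mul_pow {R : Type*} [CommRing R] (w : R) (n : ℕ) :
    (1 - 4 * w) * ∑ l ∈ range n, (l : R) * (l.centralBinom : R) * w ^ l +
        (n : R) * (n.centralBinom : R) * w ^ n =
      2 * w * ∑ l ∈ range n, (l.centralBinom : R) * w ^ l := by
  induction n with
  | zero => simp
  | succ n ih =>
    have h := congrArg (Nat.cast : ℕ → R) (Nat.succ_mul_centralBinom_succ n)
    push_cast at h
    rw [sum_range_succ, sum_range_succ]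
    push_cast
    linear_combination ih + w ^ (n + 1) * h

theorem FiniteField.sum_mul_choose_succ_mul_pow {r s : F} (hr : r ≠ 0) (hs : s ≠ 0)
    (hrs : r ≠ s) (hadd : r + s = -1) (hq : 3 ≤ Fintype.card F) :
    (1 - 4 * (r * s)) * ∑ l ∈ range ((Fintype.card F - 1) / 2 + 1),
      ((l : F) + 1) * ((2 * l).choose (l + 1) : F) * (r * s) ^ l = 2 * (r * s) := by
  have h := sum_mul_centralBinom_mul_pow (r * s) ((Fintype.card F - 1) / 2 + 1)
  rw [FiniteField.sum_centralBinom_mul_pow hr hs hrs hadd hq,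
    Nat.centralBinom_eq_two_mul_choose ((Fintype.card F - 1) / 2 + 1),
    FiniteField.cast_choose_eq_zero (by omega) (by omega) (by omega), mul_zero, zero_mul,
    add_zero, mul_one] at h
  rw [← h]
  congr 1
  refine sum_congr rfl fun l _ => ?_
  have hl := congrArg (Nat.cast : ℕ → F) (Nat.choose_succ_right_eq (2 * l) l)
  rw [show 2 * l - l = l by omega, ← Nat.centralBinom_eq_two_mul_choose] at hl
  push_cast at hl
  linear_combination (r * s) ^ l * hl

end

theorem Int.ringChoose_neg_succ (l : ℕ) :
    Ring.choose (-(l : ℤ)) (l + 1) = (-1) ^ (l + 1) * ((2 * l).choose (l + 1) : ℤ) := by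
  rw [Ring.choose_neg, show (l : ℤ) + ((l + 1 : ℕ) : ℤ) - 1 = ((2 * l : ℕ) : ℤ) by push_cast; ring,
    Ring.choose_natCast, Int.negOnePow_def, zpow_natCast, Units.smul_def]
  simp

/-- **Lemma 3.2** (Hou). Let `z ∈ F_q^*` be such that `x² + x − z` has two distinct
roots in `F_q`. Then `∑_{0 ≤ l ≤ ⌊(q−1)/2⌋} binom(−l, l+1)·z^l = 1` and
`∑_{0 ≤ l ≤ ⌊(q−1)/2⌋} (l+1)·binom(−l, l+1)·z^l = 2z/(1+4z)`. -/
theorem binom_sum_neg_l_l_add_one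
    (q : ℕ)
    (F : Type*) [Field F] [Fintype F]
    (hF : Fintype.card F = q)
    (z : F) (hz : z ≠ 0)
    (hroots : ∃ r s : F, r ≠ s ∧ r ^ 2 + r - z = 0 ∧ s ^ 2 + s - z = 0) :
    (∑ l ∈ Finset.range ((q - 1) / 2 + 1),
      ((Ring.choose (-(l : ℤ)) (l + 1) : ℤ) : F) * z ^ l = 1) ∧
    (∑ l ∈ Finset.range ((q - 1) / 2 + 1),
      ((l : F) + 1) * ((Ring.choose (-(l : ℤ)) (l + 1) : ℤ) : F) * z ^ l
      = 2 * z / (1 + 4 * z)) := by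
  subst hF
  obtain ⟨r, s, hrs, hr, hs⟩ := hroots
  have hadd : r + s = -1 := by
    have h : (r - s) * (r + s + 1) = 0 := by linear_combination hr - hs
    linear_combination (mul_eq_zero.1 h).resolve_left (sub_ne_zero.2 hrs)
  have hz' : z = -(r * s) := by linear_combination r * hadd - hr
  have hr0 : r ≠ 0 := by rintro rfl; simp_all
  have hs0 : s ≠ 0 := by rintro rfl; simp_all
  have hq : 3 ≤ Fintype.card F := by
    rw [← Finset.card_univ]
    exact Finset.two_lt_card.2 ⟨0, by simp, r, by simp, s, by simp, hr0.symm, hs0.symm, hrs⟩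
  have hden : 1 + 4 * z ≠ 0 := by
    have h : 1 + 4 * z = (r - s) ^ 2 := by
      rw [hz']
      linear_combination (1 - r - s) * hadd
    rw [h]
    exact pow_ne_zero 2 (sub_ne_zero.2 hrs)
  have term (l : ℕ) : ((Ring.choose (-(l : ℤ)) (l + 1) : ℤ) : F) * z ^ l =
      -(((2 * l).choose (l + 1) : F) * (r * s) ^ l) := by
    rw [Int.ringChoose_neg_succ, hz', neg_pow (r * s)]
    have h : ((-1 : F) ^ l) * (-1) ^ l = 1 := by rw [← mul_pow]; simp
    push_cast
    linear_combination -(((2 * l).choose (l + 1) : F) * (r * s) ^ l) * h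
  constructor
  · simp_rw [term]
    rw [Finset.sum_neg_distrib, FiniteField.sum_choose_succ_mul_pow hr0 hs0 hrs hadd hq, neg_neg]
  · simp_rw [mul_assoc ((_ : F) + 1), term, mul_neg]
    rw [Finset.sum_neg_distrib, eq_div_iff hden]
    have h := FiniteField.sum_mul_choose_succ_mul_pow hr0 hs0 hrs hadd hq
    simp_rw [mul_assoc ((_ : F) + 1)] at h
    rw [hz']
    linear_combination -h
end

section
/- Let q be any prime power and z ∈ F_q with z ≠ 0 such that the quadratic x² + x − z has two distinct roots in F_q. Then ∑_{0 ≤ l ≤ q/2} binom(l+2, 2)·binom(−l, l)·z^l equals 1 + z if q = 2, and equals (1 + 6z + 11z²)/(1 + 4z)² if q > 2. -/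
/-- The weighted Fibonacci polynomial `∑_{l ≤ n} w(l) * binom(n - l, l) * z ^ l`. -/
def weightedFib {R : Type*} [CommRing R] (z : R) (w : ℕ → R) (n : ℕ) : R :=
  ∑ l ∈ Finset.range (n + 1), w l * ((n - l).choose l : R) * z ^ l

section WeightedFib

variable {R : Type*} [CommRing R] (z : R)

lemma weightedFib_zero (w : ℕ → R) : weightedFib z w 0 = w 0 := by
  simp [weightedFib]

lemma weightedFib_one (w : ℕ → R) : weightedFib z w 1 = w 0 := by
  simp [weightedFib, Finset.sum_range_succ]

lemma weightedFib_add (w v : ℕ → R) (n : ℕ) :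
    weightedFib z (fun l => w l + v l) n = weightedFib z w n + weightedFib z v n := by
  simp only [weightedFib, ← Finset.sum_add_distrib]
  exact Finset.sum_congr rfl fun l _ => by ring

lemma weightedFib_add_two (w : ℕ → R) (n : ℕ) :
    weightedFib z w (n + 2) =
      weightedFib z w (n + 1) + z * weightedFib z (fun l => w (l + 1)) n := by
  have hterm : ∀ m ∈ Finset.range (n + 1),
      w (m + 1) * ((n + 2 - (m + 1)).choose (m + 1) : R) * z ^ (m + 1) =
        w (m + 1) * ((n + 1 - (m + 1)).choose (m + 1) : R) * z ^ (m + 1) +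
          z * (w (m + 1) * ((n - m).choose m : R) * z ^ m) := by
    intro m hm
    have hm' : m < n + 1 := Finset.mem_range.1 hm
    rw [show n + 2 - (m + 1) = (n - m) + 1 by omega, show n + 1 - (m + 1) = n - m by omega,
      Nat.choose_succ_succ]
    push_cast
    ring
  have hlast : ((n + 2 - (n + 1 + 1)).choose (n + 1 + 1) : R) = 0 := by simp
  unfold weightedFib
  rw [Finset.sum_range_succ' _ (n + 2), Finset.sum_range_succ, Finset.sum_range_succ' _ (n + 1),
    hlast, Finset.sum_congr rfl hterm, Finset.sum_add_distrib, ← Finset.mul_sum]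
  simp only [Nat.sub_zero, Nat.choose_zero_right]
  ring

lemma weightedFib_const_add_two (n : ℕ) :
    weightedFib z (fun _ => 1) (n + 2) =
      weightedFib z (fun _ => 1) (n + 1) + z * weightedFib z (fun _ => 1) n :=
  weightedFib_add_two z _ n

lemma weightedFib_linear_add_two (n : ℕ) :
    weightedFib z (fun l => (l : R) + 1) (n + 2) =
      weightedFib z (fun l => (l : R) + 1) (n + 1) +
        z * (weightedFib z (fun l => (l : R) + 1) n + weightedFib z (fun _ => 1) n) := by
  rw [weightedFib_add_two, ← weightedFib_add]
  simp only [Nat.cast_add, Nat.cast_one]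

lemma weightedFib_choose_add_two (n : ℕ) :
    weightedFib z (fun l => ((l + 2).choose 2 : R)) (n + 2) =
      weightedFib z (fun l => ((l + 2).choose 2 : R)) (n + 1) +
        z * (weightedFib z (fun l => ((l + 2).choose 2 : R)) n +
          weightedFib z (fun l => (l : R) + 1) n + weightedFib z (fun _ => 1) n) := by
  rw [weightedFib_add_two, ← weightedFib_add, ← weightedFib_add]
  have hw : ∀ l : ℕ, ((l + 1 + 2).choose 2 : R) = ((l + 2).choose 2 : R) + (l + 1) + 1 := by
    intro l
    rw [Nat.choose_succ_succ' (l + 2) 1, Nat.choose_one_right]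
    push_cast
    ring
  simp only [hw]

lemma weightedFib_linear_eq (n : ℕ) :
    (1 + 4 * z) * weightedFib z (fun l => (l : R) + 1) n =
      (2 + 4 * z + n * (1 + 2 * z)) * weightedFib z (fun _ => 1) n -
        (1 + n) * weightedFib z (fun _ => 1) (n + 1) := by
  induction n using Nat.twoStepInduction with
  | zero => simp only [weightedFib_zero, weightedFib_one, zero_add]; push_cast; ring
  | one =>
    simp only [weightedFib_const_add_two, weightedFib_zero, weightedFib_one, zero_add,
      show 1 + 1 = 0 + 2 from rfl]
    push_cast
    ring
  | more n ih₀ ih₁ =>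
    rw [weightedFib_linear_add_two, weightedFib_const_add_two z (n + 1)]
    rw [weightedFib_const_add_two] at ih₁ ⊢
    push_cast at ih₀ ih₁ ⊢
    linear_combination ih₁ + z * ih₀

/-- Closed form of the second-order weighted sum in terms of two consecutive
Fibonacci polynomials. -/
lemma weightedFib_choose_eq (n : ℕ) :
    (1 + 4 * z) ^ 2 * weightedFib z (fun l => ((l + 2).choose 2 : R)) n =
      (3 + 13 * z + 16 * z ^ 2 + n * (3 + 14 * z + 14 * z ^ 2) +
          n.choose 2 * (1 + 5 * z + 4 * z ^ 2)) * weightedFib z (fun _ => 1) n -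
        (2 + 5 * z + n * (3 + 9 * z) + n.choose 2 * (1 + 4 * z)) *
          weightedFib z (fun _ => 1) (n + 1) := by
  induction n using Nat.twoStepInduction with
  | zero => simp only [weightedFib_zero, weightedFib_one, zero_add]; norm_num; ring
  | one =>
    simp only [weightedFib_const_add_two, weightedFib_zero, weightedFib_one, zero_add,
      show 1 + 1 = 0 + 2 from rfl]
    norm_num
    ring
  | more n ih₀ ih₁ =>
    have h₁ : ((n + 1).choose 2 : R) = n.choose 2 + n := by
      rw [Nat.choose_succ_succ' n 1, Nat.choose_one_right]
      push_cast
      ring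
    have h₂ : ((n + 2).choose 2 : R) = n.choose 2 + 2 * n + 1 := by
      rw [Nat.choose_succ_succ' (n + 1) 1, Nat.choose_one_right]
      push_cast [h₁]
      ring
    have hlin := weightedFib_linear_eq z n
    rw [weightedFib_choose_add_two, weightedFib_const_add_two z (n + 1), h₂]
    rw [weightedFib_const_add_two, h₁] at ih₁
    rw [weightedFib_const_add_two]
    push_cast at ih₀ ih₁ ⊢
    linear_combination ih₁ + z * ih₀ + z * (1 + 4 * z) * hlin

/-- Binet's formula for Fibonacci polynomials. -/
lemma sub_mul_weightedFib_const {a b : R} (ha : a ^ 2 = a + z) (hb : b ^ 2 = b + z) (n : ℕ) :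
    (a - b) * weightedFib z (fun _ => 1) n = a ^ (n + 1) - b ^ (n + 1) := by
  induction n using Nat.twoStepInduction with
  | zero => simp [weightedFib_zero]
  | one => rw [weightedFib_one]; linear_combination hb - ha
  | more n ih₀ ih₁ =>
    rw [weightedFib_const_add_two]
    linear_combination ih₁ + z * ih₀ - a ^ (n + 1) * ha + b ^ (n + 1) * hb

end WeightedFib

lemma FiniteField.cast_card_choose_eq_zero (F : Type*) [Field F] [Fintype F] {k : ℕ}
    (hk : k ≠ 0) (hk' : k ≠ Fintype.card F) : ((Fintype.card F).choose k : F) = 0 := by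
  obtain ⟨p, hp⟩ := CharP.exists F
  obtain ⟨n, hprime, hn⟩ := FiniteField.card F p
  rw [CharP.cast_eq_zero_iff F p, hn]
  exact hprime.dvd_choose_pow hk (hn ▸ hk')

/-- Shifting the upper argument of a binomial coefficient by the order of a finite field. -/
lemma FiniteField.cast_choose_card_add (F : Type*) [Field F] [Fintype F] (m : ℤ) {k : ℕ}
    (hk : k < Fintype.card F) :
    ((Ring.choose ((Fintype.card F : ℤ) + m) k : ℤ) : F) = ((Ring.choose m k : ℤ) : F) := by
  rw [Ring.add_choose_eq k (Commute.all _ _), Int.cast_sum,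
    Finset.sum_eq_single_of_mem (0, k) (by simp)]
  · simp
  · rintro ⟨i, j⟩ hij hne
    rw [Finset.HasAntidiagonal.mem_antidiagonal] at hij
    have hi : i ≠ 0 := by
      rintro rfl
      exact hne (by simp_all)
    have hi' : i ≠ Fintype.card F := by
      simp only at hij
      omega
    rw [Ring.choose_natCast, Int.cast_mul, Int.cast_natCast,
      FiniteField.cast_card_choose_eq_zero F hi hi', zero_mul]


/-- **Lemma 4.2** (Hou). Let `z ∈ F_q^*` be such that `x² + x − z` has two distinct
roots in `F_q`. Then `∑_{0 ≤ l ≤ ⌊q/2⌋} binom(l+2, 2)·binom(−l, l)·z^l` equals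
`1 + z` if `q = 2`, and equals `(1 + 6z + 11z²)/(1 + 4z)²` if `q > 2`. -/
theorem binom_sum_l_add_two_choose_two_neg_l_l
    (q : ℕ)
    (F : Type*) [Field F] [Fintype F]
    (hF : Fintype.card F = q)
    (z : F) (hz : z ≠ 0)
    (hroots : ∃ r s : F, r ≠ s ∧ r ^ 2 + r - z = 0 ∧ s ^ 2 + s - z = 0) :
    (q = 2 →
      ∑ l ∈ Finset.range (q / 2 + 1),
        ((l + 2).choose 2 : F) * ((Ring.choose (-(l : ℤ)) l : ℤ) : F) * z ^ l
        = 1 + z) ∧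
    (2 < q →
      ∑ l ∈ Finset.range (q / 2 + 1),
        ((l + 2).choose 2 : F) * ((Ring.choose (-(l : ℤ)) l : ℤ) : F) * z ^ l
        = (1 + 6 * z + 11 * z ^ 2) / (1 + 4 * z) ^ 2) := by
  subst hF
  obtain ⟨r, s, hrs, hr, hs⟩ := hroots
  have hcard : (Fintype.card F : F) = 0 := FiniteField.cast_card_eq_zero F
  constructor
  · intro h2
    rw [h2] at hcard ⊢
    push_cast at hcard
    simp only [Nat.reduceDiv, Finset.sum_range_succ, Finset.sum_range_zero]
    norm_num
    linear_combination (-2 * z) * hcard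
  · intro h2
    have hne : r - s ≠ 0 := sub_ne_zero.2 hrs
    have hsum : r + s = -1 :=
      mul_left_cancel₀ hne (by linear_combination hr - hs)
    have hdisc : 1 + 4 * z ≠ 0 := by
      have : 1 + 4 * z = (r - s) ^ 2 := by
        linear_combination (-2) * hr - 2 * hs + (r + s + 1) * hsum
      rw [this]
      exact pow_ne_zero 2 hne
    have hbinet := sub_mul_weightedFib_const z (a := -r) (b := -s)
      (by linear_combination hr) (by linear_combination hs)
    have hne' : -r - -s ≠ 0 := by rwa [neg_sub_neg, sub_ne_zero, ne_comm, ← sub_ne_zero]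
    have hfib : weightedFib z (fun _ => 1) (Fintype.card F) = 1 := by
      apply mul_left_cancel₀ hne'
      rw [hbinet, pow_succ, pow_succ, FiniteField.pow_card, FiniteField.pow_card]
      linear_combination hr - hs
    have hfib' : weightedFib z (fun _ => 1) (Fintype.card F + 1) = 1 + z := by
      apply mul_left_cancel₀ hne'
      simp only [hbinet, pow_succ, FiniteField.pow_card]
      linear_combination (1 - r) * hr - (1 - s) * hs
    have hclosed := weightedFib_choose_eq z (Fintype.card F)
    rw [hfib, hfib', hcard,
      FiniteField.cast_card_choose_eq_zero F two_ne_zero h2.ne] at hclosed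
    rw [eq_div_iff (pow_ne_zero 2 hdisc)]
    have hS : ∑ l ∈ Finset.range (Fintype.card F / 2 + 1),
        ((l + 2).choose 2 : F) * ((Ring.choose (-(l : ℤ)) l : ℤ) : F) * z ^ l =
          weightedFib z (fun l => ((l + 2).choose 2 : F)) (Fintype.card F) := by
      unfold weightedFib
      rw [← Finset.sum_subset (Finset.range_subset_range.2
        (by omega : Fintype.card F / 2 + 1 ≤ Fintype.card F + 1))]
      · refine Finset.sum_congr rfl fun l hl => ?_
        rw [Finset.mem_range] at hl
        rw [← FiniteField.cast_choose_card_add F (-(l : ℤ)) (by omega), ← sub_eq_add_neg,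
          ← Nat.cast_sub (by omega), Ring.choose_natCast, Int.cast_natCast]
      · intro l _ hl
        rw [Finset.mem_range] at hl
        rw [Nat.choose_eq_zero_of_lt (n := Fintype.card F - l) (by omega)]
        simp
    rw [hS]
    linear_combination hclosed
end

section
/- Let K be any field and f = x³ + A·x² + B·x + C ∈ K[x] with roots r₁, r₂, r₃ (with multiplicity) in a splitting field of f. Then (x − (r₁²r₂ + r₂²r₃ + r₃²r₁))·(x − (r₂²r₁ + r₁²r₃ + r₃²r₂)) = x² + (AB − 3C)·x + (A³C + B³ + 9C² − 6ABC), and the discriminant of this quadratic equals the discriminant of f; that is, (AB − 3C)² − 4(A³C + B³ + 9C² − 6ABC) = A²B² + 18ABC − 4B³ − 4A³C − 27C². -/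
open Polynomial

/-- Vieta's formulas for a monic cubic written as a product of linear factors. -/
theorem cubic_coeffs_eq_of_eq_prod {R : Type*} [CommRing R] {a b c r₁ r₂ r₃ : R}
    (h : (X ^ 3 + C a * X ^ 2 + C b * X + C c : R[X]) = (X - C r₁) * (X - C r₂) * (X - C r₃)) :
    a = -(r₁ + r₂ + r₃) ∧ b = r₁ * r₂ + r₁ * r₃ + r₂ * r₃ ∧ c = -(r₁ * r₂ * r₃) := by
  have hprod : (X - C r₁) * (X - C r₂) * (X - C r₃) =
      X ^ 3 + C (-(r₁ + r₂ + r₃)) * X ^ 2 + C (r₁ * r₂ + r₁ * r₃ + r₂ * r₃) * X +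
        C (-(r₁ * r₂ * r₃)) := by
    simp only [map_add, map_mul, map_neg]
    ring
  rw [hprod] at h
  refine ⟨?_, ?_, ?_⟩
  · simpa [coeff_X, coeff_C, -map_neg, -map_add, -map_mul] using congrArg (coeff · 2) h
  · simpa [coeff_X, coeff_C, -map_neg, -map_add, -map_mul] using congrArg (coeff · 1) h
  · simpa [coeff_X, coeff_C, -map_neg, -map_add, -map_mul] using congrArg (coeff · 0) h

/-- **Theorem (K. Conrad).** Let `L` be a field (e.g. a splitting field of the cubic
`x³ + A·x² + B·x + C₀` over some field `K`) and `r₁, r₂, r₃ ∈ L` the roots of the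
cubic, i.e. `x³ + A·x² + B·x + C₀ = (x − r₁)(x − r₂)(x − r₃)` in `L[x]`. Then
`(x − (r₁²r₂ + r₂²r₃ + r₃²r₁))(x − (r₂²r₁ + r₁²r₃ + r₃²r₂))
  = x² + (AB − 3C₀)x + (A³C₀ + B³ + 9C₀² − 6ABC₀)`,
and this quadratic has the same discriminant as the cubic:
`(AB − 3C₀)² − 4(A³C₀ + B³ + 9C₀² − 6ABC₀)
  = A²B² + 18ABC₀ − 4B³ − 4A³C₀ − 27C₀²`. -/
theorem conrad_cubic_resolvent_quadratic
    (L : Type*) [Field L] (A B C₀ r₁ r₂ r₃ : L)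
    (hf : (X ^ 3 + C A * X ^ 2 + C B * X + C C₀ : L[X])
        = (X - C r₁) * (X - C r₂) * (X - C r₃)) :
    (((X - C (r₁ ^ 2 * r₂ + r₂ ^ 2 * r₃ + r₃ ^ 2 * r₁)) *
        (X - C (r₂ ^ 2 * r₁ + r₁ ^ 2 * r₃ + r₃ ^ 2 * r₂)) : L[X])
      = X ^ 2 + C (A * B - 3 * C₀) * X +
          C (A ^ 3 * C₀ + B ^ 3 + 9 * C₀ ^ 2 - 6 * A * B * C₀)) ∧
    (A * B - 3 * C₀) ^ 2 - 4 * (A ^ 3 * C₀ + B ^ 3 + 9 * C₀ ^ 2 - 6 * A * B * C₀)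
      = A ^ 2 * B ^ 2 + 18 * A * B * C₀ - 4 * B ^ 3 - 4 * A ^ 3 * C₀ - 27 * C₀ ^ 2 := by
  obtain ⟨hA, hB, hC⟩ := cubic_coeffs_eq_of_eq_prod hf
  subst hA hB hC
  constructor
  · simp only [map_add, map_sub, map_mul, map_neg, map_pow, map_ofNat]
    ring
  · ring
end

section
/- Let q > 2 be a prime power of characteristic p, and let n = q^α − q^β − 1 where 0 < β < α < 2p, β is odd, and β ≠ p. Write α − β = a₀ + 2a₁ with a₀ ∈ {0,1} and a₁ ∈ ℕ, and β = 1 + 2b₁ with b₁ ∈ ℕ. Set A = (1/β)(−a₀b₁ + b₁ + a₁), B = a₀ − (b₁ + 1)/β, and C = −(1/β)(a₀b₁ + a₀ + a₁), all computed in F_p ⊆ F_q (β is invertible in F_p since β is odd, β < 2p, β ≠ p). Then there exists a bijection φ : F_{q²} → F_{q²} such that g_{n,q}(x) = A·φ(x) + B·φ(x)^q + C·φ(x)^(2q−1) for all x ∈ F_{q²}. -/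
open Polynomial

section FrobeniusIdentities

variable {F L : Type*} [Field F] [Fintype F] [Field L] [Algebra F L]

theorem add_pow_card_of_algebra (a b : L) :
    (a + b) ^ Fintype.card F = a ^ Fintype.card F + b ^ Fintype.card F :=
  map_add (FiniteField.frobeniusAlgHom F L) a b

theorem algebraMap_mul_pow_card (c : F) (a : L) :
    (algebraMap F L c * a) ^ Fintype.card F = algebraMap F L c * a ^ Fintype.card F := by
  rw [mul_pow, ← map_pow, FiniteField.pow_card]

theorem natCast_mul_pow_card (k : ℕ) (a : L) :
    ((k : L) * a) ^ Fintype.card F = k * a ^ Fintype.card F := by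
  simpa using algebraMap_mul_pow_card (k : F) a

theorem FiniteField.sum_pow_card_sub_one : ∑ c : F, c ^ (Fintype.card F - 1) = -1 := by
  classical
  have h : ∀ c : F, c ^ (Fintype.card F - 1) = 1 - if c = 0 then 1 else 0 := by
    intro c
    have := Fintype.one_lt_card (α := F)
    split_ifs with hc
    · rw [hc, zero_pow (by omega), sub_self]
    · rw [FiniteField.pow_card_sub_one_eq_one c hc, sub_zero]
  simp [h]

theorem sum_add_algebraMap_pow_card_sub_one (y : L) :
    ∑ c : F, (y + algebraMap F L c) ^ (Fintype.card F - 1) = -1 := by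
  simp_rw [add_comm y, add_pow]
  rw [Finset.sum_comm, Finset.sum_range_succ, Finset.sum_eq_zero]
  · have := congrArg (algebraMap F L) (FiniteField.sum_pow_card_sub_one (F := F))
    simpa using this
  · intro i hi
    have := congrArg (algebraMap F L)
      (FiniteField.sum_pow_lt_card_sub_one F i (Finset.mem_range.mp hi))
    rw [map_sum, map_zero] at this
    simp_rw [map_pow] at this
    rw [← Finset.sum_mul, ← Finset.sum_mul, this, zero_mul, zero_mul]

theorem add_algebraMap_pow_card {x y : L} (h : y ^ Fintype.card F = y + x) (c : F) :
    (y + algebraMap F L c) ^ Fintype.card F = y + algebraMap F L c + x := by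
  rw [add_pow_card_of_algebra, ← map_pow, FiniteField.pow_card, h]
  ring

theorem ne_zero_of_pow_eq_add {L : Type*} [Field L] {x z : L} {m : ℕ} (hm : m ≠ 0)
    (hx : x ≠ 0) (h : z ^ m = z + x) : z ≠ 0 := by
  rintro rfl
  rw [zero_pow hm, zero_add] at h
  exact hx h.symm

theorem sum_inv_add_algebraMap {x y : L} (hx : x ≠ 0) (h : y ^ Fintype.card F = y + x) :
    ∑ c : F, (y + algebraMap F L c)⁻¹ = -x⁻¹ := by
  have key : ∀ c : F, (y + algebraMap F L c)⁻¹ =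
      x⁻¹ * ((y + algebraMap F L c) ^ (Fintype.card F - 1) - 1) := by
    intro c
    have hc := add_algebraMap_pow_card h c
    have hz := ne_zero_of_pow_eq_add Fintype.card_ne_zero hx hc
    rw [← Nat.sub_add_cancel (Fintype.card_pos (α := F)), pow_succ] at hc
    field_simp
    linear_combination -hc
  have hq : ((Fintype.card F : ℕ) : L) = 0 := by
    rw [← map_natCast (algebraMap F L), FiniteField.cast_card_eq_zero, map_zero]
  simp_rw [key]
  rw [← Finset.mul_sum, Finset.sum_sub_distrib, sum_add_algebraMap_pow_card_sub_one]
  simp [hq]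

theorem pow_card_pow_two_mul {x z : L} (hx : (x ^ Fintype.card F) ^ Fintype.card F = x)
    (h : z ^ Fintype.card F = z + x) (k : ℕ) :
    z ^ Fintype.card F ^ (2 * k) = z + k * (x + x ^ Fintype.card F) := by
  induction k with
  | zero => simp
  | succ k ih =>
    rw [mul_add, mul_one, pow_add, pow_mul, ih, sq, pow_mul]
    simp only [add_pow_card_of_algebra, natCast_mul_pow_card, h, hx]
    push_cast
    ring

theorem pow_card_pow_two_mul_add_one {x z : L}
    (hx : (x ^ Fintype.card F) ^ Fintype.card F = x)
    (h : z ^ Fintype.card F = z + x) (k : ℕ) :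
    z ^ Fintype.card F ^ (2 * k + 1) = z + (x + k * (x + x ^ Fintype.card F)) := by
  rw [pow_succ, pow_mul, pow_card_pow_two_mul hx h]
  simp only [add_pow_card_of_algebra, natCast_mul_pow_card, h, hx]
  ring

theorem eq_zero_of_natCast_mul_add_eq_zero {b : ℕ} (hb : (1 + 2 * b : L) ≠ 0) {y : L}
    (hy : (y ^ Fintype.card F) ^ Fintype.card F = y)
    (h : (1 + b : L) * y ^ Fintype.card F + b * y = 0) : y = 0 := by
  have h' := congrArg (· ^ Fintype.card F) h
  simp only [add_pow_card_of_algebra, add_mul, one_mul, natCast_mul_pow_card, hy,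
    zero_pow Fintype.card_ne_zero] at h'
  have hsum : y + y ^ Fintype.card F = 0 := by
    apply (mul_eq_zero.mp _).resolve_left hb
    linear_combination h + h'
  linear_combination (1 + b : L) * hsum - h

theorem bijective_natCast_mul_inv_pow_add [Finite L]
    (hL : ∀ x : L, (x ^ Fintype.card F) ^ Fintype.card F = x) {b : ℕ}
    (hb : (1 + 2 * b : L) ≠ 0) :
    Function.Bijective fun x : L ↦ (1 + b : L) * x⁻¹ ^ Fintype.card F + b * x⁻¹ := by
  refine Finite.injective_iff_bijective.mp fun x y hxy ↦ inv_injective (sub_eq_zero.mp ?_)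
  apply eq_zero_of_natCast_mul_add_eq_zero (F := F) hb (hL _)
  have : (x⁻¹ - y⁻¹) ^ Fintype.card F = x⁻¹ ^ Fintype.card F - y⁻¹ ^ Fintype.card F :=
    map_sub (FiniteField.frobeniusAlgHom F L) _ _
  rw [this]
  linear_combination hxy

theorem sum_add_algebraMap_pow {x y u s : L} {α β n : ℕ}
    (hx : x ≠ 0) (hu : u ≠ 0) (h : y ^ Fintype.card F = y + x)
    (hβ : ∀ z : L, z ^ Fintype.card F = z + x → z ^ Fintype.card F ^ β = z + u)
    (hα : ∀ z : L, z ^ Fintype.card F = z + x → z ^ Fintype.card F ^ α = z + s)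
    (hxu : u ^ Fintype.card F + x = u + x ^ Fintype.card F)
    (hn : n + 1 + Fintype.card F ^ β = Fintype.card F ^ α) :
    ∑ c : F, (y + algebraMap F L c) ^ n =
      -(s / u * x⁻¹) - (1 - s / u) * (x ^ Fintype.card F)⁻¹ := by
  have key : ∀ c : F, (y + algebraMap F L c) ^ n =
      s / u * (y + algebraMap F L c)⁻¹ + (1 - s / u) * (y + u + algebraMap F L c)⁻¹ := by
    intro c
    have hc := add_algebraMap_pow_card h c
    have hz := ne_zero_of_pow_eq_add Fintype.card_ne_zero hx hc
    have hzu : y + algebraMap F L c + u ≠ 0 := hβ _ hc ▸ pow_ne_zero _ hz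
    have hpow := hα _ hc
    rw [← hn, pow_add, pow_succ, hβ _ hc] at hpow
    rw [add_right_comm y u]
    generalize y + algebraMap F L c = z at *
    field_simp
    linear_combination u * hpow
  have hyu : (y + u) ^ Fintype.card F = y + u + x ^ Fintype.card F := by
    rw [add_pow_card_of_algebra, h]
    linear_combination hxu
  simp_rw [key]
  rw [Finset.sum_add_distrib, ← Finset.mul_sum, ← Finset.mul_sum, sum_inv_add_algebraMap hx h,
    sum_inv_add_algebraMap (pow_ne_zero _ hx) hyu]
  ring

theorem sum_pow_eq_zero_of_add_one_add_card_pow (hF : 2 < Fintype.card F) {α β n : ℕ}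
    (hn0 : n ≠ 0) (hn : n + 1 + Fintype.card F ^ β = Fintype.card F ^ α) :
    ∑ c : F, c ^ n = 0 := by
  have key : ∀ c : F, c ^ n = c⁻¹ := by
    intro c
    rcases eq_or_ne c 0 with rfl | hc
    · simp [hn0]
    · have := FiniteField.pow_card_pow α c
      rw [← hn, pow_add, pow_succ, FiniteField.pow_card_pow] at this
      field_simp
      exact mul_right_cancel₀ hc (by rw [this, one_mul])
  simp_rw [key]
  refine (Equiv.sum_comp (Equiv.inv F) fun c ↦ c).trans ?_
  simpa using FiniteField.sum_pow_lt_card_sub_one F 1 (by omega)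

end FrobeniusIdentities

/-- **Lemma 6.1** (Hou). Let `q > 2` be a power of the prime `p`, and
`n = q^α − q^β − 1` with `0 < β < α < 2p`, `β` odd, `β ≠ p`. Write
`α − β = a₀ + 2a₁` (`a₀ ∈ {0,1}`) and `β = 1 + 2b₁`. Let `g = g_{n,q}` be the
polynomial over `F_q` with `∑_{c ∈ F_q} (X + c)^n = g(X^q − X)`. Then there is a
bijection `φ` of `F_{q²}` with
`g(x) = A·φ(x) + B·φ(x)^q + C·φ(x)^{2q−1}` for all `x ∈ F_{q²}`, where
`A = β⁻¹(−a₀b₁ + b₁ + a₁)`, `B = a₀ − (b₁+1)β⁻¹`, `C = −β⁻¹(a₀b₁ + a₀ + a₁)`. -/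
theorem g_nq_trinomial_form
    (p q : ℕ) [Fact p.Prime]
    (F K : Type*) [Field F] [Field K] [Algebra F K]
    [Fintype F] [Fintype K] [CharP F p]
    (hF : Fintype.card F = q) (hK : Fintype.card K = q ^ 2) (hq : 2 < q)
    (α β a₀ a₁ b₁ : ℕ)
    (hβ0 : 0 < β) (hβα : β < α) (hα : α < 2 * p)
    (hβodd : Odd β) (hβp : β ≠ p)
    (ha₀ : a₀ ≤ 1) (hαβ : α - β = a₀ + 2 * a₁) (hβb₁ : β = 1 + 2 * b₁)
    (n : ℕ) (hn : n = q ^ α - q ^ β - 1)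
    (g : F[X])
    (hg : ∑ c : F, (X + C c) ^ n = g.comp (X ^ q - X)) :
    ∃ φ : K → K, Function.Bijective φ ∧ ∀ x : K,
      Polynomial.aeval x g =
        algebraMap F K ((β : F)⁻¹ * (-((a₀ : F) * (b₁ : F)) + (b₁ : F) + (a₁ : F)))
            * φ x +
        algebraMap F K ((a₀ : F) - ((b₁ : F) + 1) * (β : F)⁻¹) * (φ x) ^ q +
        algebraMap F K (-(β : F)⁻¹ * ((a₀ : F) * (b₁ : F) + (a₀ : F) + (a₁ : F)))
            * (φ x) ^ (2 * q - 1) := by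
  subst hF
  have hb : (1 + 2 * b₁ : F) ≠ 0 := by
    have h := (CharP.cast_eq_zero_iff F p β).not.mpr (by
      rintro ⟨k, hk⟩
      have : k < 2 := by
        by_contra! hk2
        have := Nat.mul_le_mul_left p hk2
        omega
      interval_cases k <;> omega)
    simpa [hβb₁] using h
  have hbK : (1 + 2 * b₁ : K) ≠ 0 := by
    simpa only [map_add, map_mul, map_one, map_ofNat, map_natCast] using
      (map_ne_zero (algebraMap F K)).mpr hb
  have hK2 (x : K) : (x ^ Fintype.card F) ^ Fintype.card F = x := by
    rw [← pow_mul, ← sq, ← hK, FiniteField.pow_card]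
  have hlt : Fintype.card F ^ β * 3 ≤ Fintype.card F ^ α :=
    (Nat.mul_le_mul_left _ hq).trans (pow_succ (Fintype.card F) β ▸
      Nat.pow_le_pow_right (by omega) hβα)
  have hpos : 0 < Fintype.card F ^ β := by positivity
  have hsum : n + 1 + Fintype.card F ^ β = Fintype.card F ^ α := by omega
  refine ⟨_, bijective_natCast_mul_inv_pow_add hK2 hbK, fun x ↦ ?_⟩
  rcases eq_or_ne x 0 with rfl | hx
  · have h0 := congrArg (eval 0) hg
    simp only [eval_finsetSum, eval_pow, eval_add, eval_X, eval_C, zero_add, eval_comp, eval_sub,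
      zero_pow Fintype.card_ne_zero, sub_zero,
      sum_pow_eq_zero_of_add_one_add_card_pow hq (by omega) hsum] at h0
    have hg0 : aeval (0 : K) g = 0 := by
      rw [← map_zero (algebraMap F K), aeval_algebraMap_apply, coe_aeval_eq_eval, ← h0]
    rw [hg0]
    simp [show 2 * Fintype.card F - 1 ≠ 0 by omega]
  set L := AlgebraicClosure K
  obtain ⟨y, hy⟩ : ∃ y : L, y ^ Fintype.card F = y + algebraMap K L x := by
    have hd : (X ^ Fintype.card F - (X + C (algebraMap K L x)) : L[X]).degree ≠ 0 := by
      rw [degree_sub_eq_left_of_degree_lt] <;> rw [degree_X_pow]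
      · exact_mod_cast Fintype.card_ne_zero
      · rw [degree_X_add_C]
        exact_mod_cast (by omega : 1 < Fintype.card F)
    obtain ⟨y, hy⟩ := IsAlgClosed.exists_root _ hd
    exact ⟨y, by simpa [sub_eq_zero] using hy⟩
  set u : K := x + b₁ * (x + x ^ Fintype.card F) with hu_def
  set s : K := u + a₀ * x ^ Fintype.card F + a₁ * (x + x ^ Fintype.card F) with hs_def
  have hxL : (algebraMap K L x ^ Fintype.card F) ^ Fintype.card F = algebraMap K L x := by
    rw [← map_pow, ← map_pow, hK2]
  have huq : u ^ Fintype.card F =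
      x ^ Fintype.card F + b₁ * (x + x ^ Fintype.card F) := by
    rw [hu_def]
    simp only [add_pow_card_of_algebra, natCast_mul_pow_card, hK2]
    ring
  have hu : u ≠ 0 := by
    intro hu
    apply pow_ne_zero (Fintype.card F) hx
    apply eq_zero_of_natCast_mul_add_eq_zero (F := F) hbK (hK2 _)
    rw [hK2]
    linear_combination hu
  have hval : aeval x g = -(s / u * x⁻¹) - (1 - s / u) * (x ^ Fintype.card F)⁻¹ := by
    apply (algebraMap K L).injective
    rw [← aeval_algebraMap_apply]
    have hgy := congrArg (aeval y) hg
    rw [aeval_comp, map_sum] at hgy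
    simp only [map_pow, map_add, aeval_X, aeval_C, map_sub, hy, add_sub_cancel_left] at hgy
    rw [← hgy, sum_add_algebraMap_pow (u := algebraMap K L u) (s := algebraMap K L s)
      (α := α) (β := β) (by simpa using hx) (by simpa using hu) hy _ _ _ hsum]
    · simp
    · intro z hz
      rw [hβb₁, add_comm 1, pow_card_pow_two_mul_add_one hxL hz]
      simp [hu_def]
    · intro z hz
      interval_cases a₀
      · rw [show α = 2 * (b₁ + a₁) + 1 by omega, pow_card_pow_two_mul_add_one hxL hz]
        simp [hu_def, hs_def]
        ring
      · rw [show α = 2 * (b₁ + a₁ + 1) by omega, pow_card_pow_two_mul hxL hz]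
        simp [hu_def, hs_def]
        ring
    · rw [← map_pow, ← map_pow, ← map_add, ← map_add, huq, hu_def]
      congr 1
      ring
  have hφ : (1 + b₁ : K) * x⁻¹ ^ Fintype.card F + b₁ * x⁻¹ =
      u / (x * x ^ Fintype.card F) := by
    rw [hu_def, inv_pow]
    field_simp
    ring
  have hφq : (u / (x * x ^ Fintype.card F)) ^ Fintype.card F =
      u ^ Fintype.card F / (x * x ^ Fintype.card F) := by
    rw [div_pow, mul_pow, hK2, mul_comm x]
  have hpow : (u / (x * x ^ Fintype.card F)) ^ (2 * Fintype.card F - 1) =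
      (u ^ Fintype.card F) ^ 2 / (u * (x * x ^ Fintype.card F)) := by
    have hw : u / (x * x ^ Fintype.card F) ≠ 0 :=
      div_ne_zero hu (mul_ne_zero hx (pow_ne_zero _ hx))
    rw [pow_sub₀ _ hw (by omega), mul_comm 2, pow_mul, hφq]
    field_simp
  have hβF : (β : F) = 1 + 2 * b₁ := by rw [hβb₁]; push_cast; ring
  simp only [hφ, hφq, hpow, hval, hβF, huq]
  simp only [map_add, map_sub, map_mul, map_neg, map_inv₀, map_natCast, map_one, map_ofNat]
  have hxq := pow_ne_zero (Fintype.card F) hx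
  rw [hs_def]
  generalize x ^ Fintype.card F = w at *
  field_simp
  rw [hu_def]
  ring
end

section
/- Let q be an even prime power and (a, b, c) ∈ F_q³ with (a, b, c) ≠ (0, 0, 0). Then a·x + b·x^q + c·x^(2q−1) is a permutation polynomial of F_{q²} if and only if (a, b, c) is a nonzero F_q-scalar multiple of one of the following triples: (1 + d² + d⁴, 1 + d + d², d² + d⁴) for some d ∈ F_q \ F_2; (d + d², 1, d + d²) for some d ∈ F_q \ F_2; (d, 1, 0) for some d ∈ F_q with d ≠ 1; or (1, 0, 0). -/
/-- The additive endomorphism `y ↦ y² + y` of a field of characteristic two. -/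
def artinSchreierHom (F : Type*) [Field F] [CharP F 2] : F →+ F where
  toFun y := y ^ 2 + y
  map_zero' := by simp
  map_add' x y := by rw [CharTwo.add_sq]; ring

/-- The image of `y ↦ y² + y`; for finite `F` this is the kernel of the absolute trace. -/
def artinSchreierRange (F : Type*) [Field F] [CharP F 2] : AddSubgroup F :=
  (artinSchreierHom F).range

section FiniteFieldChar2

variable {F : Type*} [Field F] [CharP F 2]

theorem mem_artinSchreierRange {x : F} : x ∈ artinSchreierRange F ↔ ∃ y, y ^ 2 + y = x :=
  Iff.rfl

theorem sq_add_mem (x : F) : x ^ 2 + x ∈ artinSchreierRange F := ⟨x, rfl⟩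

theorem sq_mem_artinSchreierRange_iff {x : F} :
    x ^ 2 ∈ artinSchreierRange F ↔ x ∈ artinSchreierRange F := by
  rw [← (artinSchreierRange F).add_mem_cancel_right (sq_add_mem x)]
  congr! 1
  grind

theorem add_sq_add_mem_iff {x : F} (y : F) :
    x + (y ^ 2 + y) ∈ artinSchreierRange F ↔ x ∈ artinSchreierRange F :=
  (artinSchreierRange F).add_mem_cancel_right (sq_add_mem y)

theorem eq_or_eq_add_one_of_sq_add_eq {x y : F} (h : x ^ 2 + x = y ^ 2 + y) :
    x = y ∨ x = y + 1 := by
  have : (x + y) * (x + y + 1) = 0 := by grind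
  rcases mul_eq_zero.mp this with h | h
  · left; grind
  · right; grind

theorem card_ker_artinSchreierHom : Nat.card (artinSchreierHom F).ker = 2 := by
  have : ((artinSchreierHom F).ker : Set F) = {0, 1} := by
    ext x
    have : x ^ 2 + x = 0 ↔ x = 0 ∨ x = 1 := by grind
    simpa [AddMonoidHom.mem_ker, artinSchreierHom] using this
  rw [← SetLike.coe_sort_coe, this, Nat.card_coe_set_eq, Set.ncard_pair zero_ne_one]

variable [Finite F]

theorem index_artinSchreierRange : (artinSchreierRange F).index = 2 := by
  have h₁ := (artinSchreierHom F).ker.card_mul_index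
  rw [AddSubgroup.index_ker, card_ker_artinSchreierHom,
    ← (artinSchreierHom F).range.card_mul_index, mul_comm] at h₁
  exact (Nat.eq_of_mul_eq_mul_left Nat.card_pos h₁).symm

theorem add_mem_artinSchreierRange_iff {x y : F} :
    x + y ∈ artinSchreierRange F ↔ (x ∈ artinSchreierRange F ↔ y ∈ artinSchreierRange F) :=
  AddSubgroup.add_mem_iff_of_index_two index_artinSchreierRange

theorem exists_sq_eq (x : F) : ∃ y, y ^ 2 = x := by
  obtain ⟨y, rfl⟩ := FiniteField.isSquare_of_char_two (ringChar.eq F 2) x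
  exact ⟨y, sq y⟩

theorem exists_not_mem_and_div_not_mem {k l : F} (hk : k ≠ 0) (hl : l ≠ 0) :
    ∃ u ≠ 0, k * u ∉ artinSchreierRange F ∧ l / u ∉ artinSchreierRange F := by
  by_contra! h
  let P : Set F := artinSchreierRange F
  have hmaps : Set.MapsTo (fun x => l * k / x) Pᶜ (P \ {0}) := by
    intro x hx
    have hx0 : x ≠ 0 := by
      rintro rfl
      exact hx (zero_mem (artinSchreierRange F))
    have := h (x / k) (div_ne_zero hx0 hk) (by rwa [mul_div_cancel₀ _ hk])
    rw [div_div_eq_mul_div] at this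
    exact ⟨this, div_ne_zero (mul_ne_zero hl hk) hx0⟩
  have hinj : Set.InjOn (fun x => l * k / x) Pᶜ := by
    intro x _ y _ hxy
    simp only [div_eq_mul_inv] at hxy
    exact inv_injective (mul_left_cancel₀ (mul_ne_zero hl hk) hxy)
  have h₁ := Set.ncard_le_ncard_of_injOn _ hmaps hinj
  have h₂ : (P \ {0}).ncard + 1 = P.ncard :=
    Set.ncard_sdiff_singleton_add_one (zero_mem (artinSchreierRange F))
  have h₃ := Set.ncard_add_ncard_compl P
  have h₄ := (artinSchreierRange F).card_mul_index
  rw [index_artinSchreierRange] at h₄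
  have h₅ : Nat.card (artinSchreierRange F) = P.ncard := Nat.card_coe_set_eq P
  omega

theorem exists_mem_and_div_not_mem {k l : F} (hk : k ≠ 0) (hl : l ≠ 0) :
    (∃ u ≠ 0, k * u ∈ artinSchreierRange F ∧ l / u ∉ artinSchreierRange F) ∨
      ∀ y : F, y ^ 2 + y = 0 ∨ y ^ 2 + y = 1 := by
  rw [or_iff_not_imp_left]
  intro h
  push Not at h
  have hr : l * k ≠ 0 := mul_ne_zero hl hk
  have hinv : ∀ x ∈ artinSchreierRange F, l * k / x ∈ artinSchreierRange F := by
    intro x hx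
    rcases eq_or_ne x 0 with rfl | hx0
    · simp [zero_mem]
    · have := h (x / k) (div_ne_zero hx0 hk) (by rwa [mul_div_cancel₀ _ hk])
      rwa [div_div_eq_mul_div] at this
  have hdiv : ∀ x ∈ artinSchreierRange F, ∀ y ∈ artinSchreierRange F,
      x / y ∈ artinSchreierRange F := by
    intro z hz y hy
    obtain ⟨x, rfl⟩ := exists_sq_eq z
    rw [sq_mem_artinSchreierRange_iff] at hz
    rcases eq_or_ne x 0 with rfl | hx0
    · simp [zero_mem]
    rcases eq_or_ne y 0 with rfl | hy0
    · simp [zero_mem]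
    rcases eq_or_ne x y with rfl | hxy
    · rwa [sq, mul_div_cancel_right₀ _ hx0]
    have hxy0 : x + y ≠ 0 := fun h => hxy (CharTwo.add_eq_zero.mp h)
    have h₁ := hinv _ (add_mem (hinv x hz) (hinv (x + y) (add_mem hz hy)))
    have h₂ : l * k / (l * k / x + l * k / (x + y)) = x ^ 2 / y + x := by
      have : l * k / x + l * k / (x + y) = l * k * y / (x * (x + y)) := by
        have h2 : (2 : F) = 0 := CharTwo.two_eq_zero
        field_simp
        linear_combination x * h2
      rw [this]
      field_simp
    rw [h₂] at h₁
    exact ((artinSchreierRange F).add_mem_cancel_right hz).mp h₁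
  obtain ⟨c, hc⟩ : ∃ c, c ∉ artinSchreierRange F := by
    by_contra! hall
    have := (AddSubgroup.eq_top_iff' _).mpr hall
    have h₂ := index_artinSchreierRange (F := F)
    rw [this, AddSubgroup.index_top] at h₂
    omega
  have hmul : ∀ x ∈ artinSchreierRange F, x ≠ 0 → x * c ∉ artinSchreierRange F := by
    intro x hx hx0 hxc
    have := hdiv _ hxc _ hx
    rw [mul_div_cancel_left₀ _ hx0] at this
    exact hc this
  intro y
  by_contra! hy
  have hmem := sq_add_mem y
  have hone : (1 : F) ∈ artinSchreierRange F := by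
    simpa [div_self hy.1] using hdiv _ hmem _ hmem
  have h₁ := hmul _ hmem hy.1
  have h₂ := hmul _ (add_mem hmem hone) (fun h => hy.2 (CharTwo.add_eq_zero.mp h))
  rw [add_mul, one_mul, add_mem_artinSchreierRange_iff] at h₂
  tauto


/-- The affine conic `w² + bwv + av² = (a + b + 1)²` contains no point with `w⁻¹` of trace one and
`v⁻¹` either zero or of trace one, and `a + b + 1 ≠ 0`. -/
def ConicAvoids (a b : F) : Prop :=
  a + b + 1 ≠ 0 ∧ ∀ w v : F, w⁻¹ ∉ artinSchreierRange F →
    (v = 0 ∨ v⁻¹ ∉ artinSchreierRange F) →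
    w ^ 2 + b * w * v + a * v ^ 2 + (a + b + 1) ^ 2 ≠ 0

omit [Finite F] in
theorem conicAvoids_one {b d : F} (hb : b * (d + d ^ 2) = 1) : ConicAvoids 1 b := by
  have hb0 : b ≠ 0 := left_ne_zero_of_mul_eq_one hb
  have hd : d ^ 2 + d = b⁻¹ := by grind
  have he : 1 + b + 1 = b := by grind
  refine ⟨by rwa [he], fun w v hw hv hc => ?_⟩
  rw [he] at hc
  have hbP : b⁻¹ ∈ artinSchreierRange F := ⟨d, hd⟩
  rcases hv with rfl | hv
  · have : w = b := CharTwo.sq_injective (by grind)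
    exact hw (this ▸ hbP)
  · have hv0 : v ≠ 0 := by
      rintro rfl
      exact hv (by simp [zero_mem])
    have : v⁻¹ = (b⁻¹) ^ 2 + (((w + b) / (b * v)) ^ 2 + (w + b) / (b * v)) := by
      field_simp
      grind
    rw [this, add_sq_add_mem_iff, sq_mem_artinSchreierRange_iff] at hv
    exact hv hbP

omit [Finite F] in
theorem conicAvoids_of_add_one {e d : F} (he : e * (d + d ^ 2) = 1) :
    ConicAvoids (1 + e ^ 2) (e + e ^ 2) := by
  have he0 : e ≠ 0 := left_ne_zero_of_mul_eq_one he
  have hd : d ^ 2 + d = e⁻¹ := by grind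
  have hsum : 1 + e ^ 2 + (e + e ^ 2) + 1 = e := by grind
  refine ⟨by rwa [hsum], fun w v hw _ hc => ?_⟩
  rw [hsum] at hc
  have heP : e⁻¹ ∈ artinSchreierRange F := ⟨d, hd⟩
  have hw0 : w ≠ 0 := by
    rintro rfl
    exact hw (by simp [zero_mem])
  have : w⁻¹ = e⁻¹ + (((w + (1 + e) * v + e) / (e * w)) ^ 2 +
      (w + (1 + e) * v + e) / (e * w)) := by
    field_simp
    grind
  rw [this, add_sq_add_mem_iff] at hw
  exact hw heP

theorem not_conicAvoids_of_b_eq_zero {s : F} (hs0 : s ≠ 0) (hs1 : 1 + s ≠ 0)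
    (he : ((1 + s) ^ 2)⁻¹ ∈ artinSchreierRange F) : ¬ ConicAvoids (s ^ 2) 0 := by
  rintro ⟨-, h⟩
  have hsum : s ^ 2 + 0 + 1 = (1 + s) ^ 2 := by grind
  rw [hsum] at h
  have hsP : s / (1 + s) ^ 2 ∈ artinSchreierRange F := by
    refine mem_artinSchreierRange.mpr ⟨(1 + s)⁻¹, ?_⟩
    field_simp
    grind
  obtain ⟨u, hu0, hu₁, hu₂⟩ := exists_not_mem_and_div_not_mem
    (inv_ne_zero (pow_ne_zero 2 hs1)) (div_ne_zero hs0 (pow_ne_zero 2 hs1))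
  have hv : (u + s) / (1 + s) ^ 2 ∉ artinSchreierRange F := by
    rw [show (u + s) / (1 + s) ^ 2 = ((1 + s) ^ 2)⁻¹ * u + s / (1 + s) ^ 2 by ring,
      (artinSchreierRange F).add_mem_cancel_right hsP]
    exact hu₁
  have hus : u + s ≠ 0 := by
    intro h0
    rw [h0, zero_div] at hv
    exact hv (zero_mem _)
  refine h ((1 + s) ^ 2 * u / (u + s)) ((1 + s) ^ 2 / (u + s)) ?_ (Or.inr (by rwa [inv_div])) ?_
  · rw [inv_div, show (u + s) / ((1 + s) ^ 2 * u) = ((1 + s) ^ 2)⁻¹ + s / (1 + s) ^ 2 / u by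
      field_simp, (artinSchreierRange F).add_mem_cancel_left he]
    exact hu₂
  · field_simp
    grind

omit [Finite F] in
theorem not_conicAvoids_of_params {e s b n : F} (he0 : e ≠ 0) (hb0 : b ≠ 0) (hn0 : n ≠ 0)
    (hsum : s ^ 2 + b + 1 = e) (he : e⁻¹ ∈ artinSchreierRange F)
    (h₁ : (s ^ 2 + 1) / (b * e ^ 2) * n ^ 2 + s / e ∉ artinSchreierRange F)
    (h₂ : (b ^ 2 + b * s * e) / e ^ 2 / n ^ 2 ∉ artinSchreierRange F) :
    ¬ ConicAvoids (s ^ 2) b := by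
  rintro ⟨-, h⟩
  rw [hsum] at h
  have hv : (n ^ 2 + b * n + b * s) / (b * e) ∉ artinSchreierRange F := by
    have : (n ^ 2 + b * n + b * s) / (b * e) =
        (s ^ 2 + 1) / (b * e ^ 2) * n ^ 2 + s / e + ((n / e) ^ 2 + n / e) := by
      field_simp
      grind
    rwa [this, add_sq_add_mem_iff]
  have hw : (n ^ 2 + b * n + b * s) / (e * n ^ 2) ∉ artinSchreierRange F := by
    have : (n ^ 2 + b * n + b * s) / (e * n ^ 2) =
        e⁻¹ + ((b ^ 2 + b * s * e) / e ^ 2 / n ^ 2 +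
          ((b / (e * n)) ^ 2 + b / (e * n))) := by
      field_simp
      grind
    rwa [this, (artinSchreierRange F).add_mem_cancel_left he, add_sq_add_mem_iff]
  have hD : n ^ 2 + b * n + b * s ≠ 0 := by
    intro h0
    rw [h0, zero_div] at hv
    exact hv (zero_mem _)
  refine h (e * n ^ 2 / (n ^ 2 + b * n + b * s)) (b * e / (n ^ 2 + b * n + b * s))
    (by rwa [inv_div]) (Or.inr (by rwa [inv_div])) ?_
  generalize hDef : n ^ 2 + b * n + b * s = D at hD
  field_simp
  grind

omit [Finite F] in
theorem not_conicAvoids_of_card_four {b : F} (hF : ∀ y : F, y ^ 2 + y = 0 ∨ y ^ 2 + y = 1)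
    (hb : b ^ 2 + b = 1) : ¬ ConicAvoids b b := by
  rintro ⟨-, h⟩
  have hb0 : b ≠ 0 := by rintro rfl; simp at hb
  have hb3 : b * b ^ 2 = 1 := by grind
  have hmem : ∀ x : F, x ^ 2 + x = 1 → x ∉ artinSchreierRange F := by
    intro x hx hxP
    obtain ⟨y, rfl⟩ := mem_artinSchreierRange.mp hxP
    rcases hF y with h | h <;> rw [h] at hx <;> grind
  refine h (b ^ 2) b ?_ (Or.inr ?_) (by grind)
  · rw [inv_eq_of_mul_eq_one_left hb3]
    exact hmem b hb
  · rw [inv_eq_of_mul_eq_one_right hb3]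
    exact hmem _ (by grind)

theorem eq_or_eq_of_conicAvoids {s b : F} (h : ConicAvoids (s ^ 2) b)
    (h4 : ∃ d : F, d ^ 2 + d ≠ 0 ∧ (s ^ 2 + b + 1)⁻¹ = d ^ 2 + d) :
    s ^ 2 = 1 ∨ s = 1 + (s ^ 2 + b + 1) := by
  by_contra! hne
  obtain ⟨hs1, hse⟩ := hne
  obtain ⟨d, hd0, hd⟩ := h4
  have he0 := h.1
  have he : (s ^ 2 + b + 1)⁻¹ ∈ artinSchreierRange F := ⟨d, hd.symm⟩
  have hs1' : 1 + s ≠ 0 := by grind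
  rcases eq_or_ne b 0 with rfl | hb0
  · refine not_conicAvoids_of_b_eq_zero (by grind) hs1' ?_ h
    convert! he using 2
    grind
  generalize hsum : s ^ 2 + b + 1 = e at *
  have hk : (s ^ 2 + 1) / (b * e ^ 2) ≠ 0 := by
    refine div_ne_zero ?_ (mul_ne_zero hb0 (pow_ne_zero 2 he0))
    grind
  have hl : (b ^ 2 + b * s * e) / e ^ 2 ≠ 0 := by
    refine div_ne_zero ?_ (pow_ne_zero 2 he0)
    intro h0
    have : b * ((1 + s) * (s + 1 + e)) = 0 := by grind
    grind
  by_cases hse : s / e ∈ artinSchreierRange F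
  · obtain ⟨u, hu0, hu₁, hu₂⟩ := exists_not_mem_and_div_not_mem hk hl
    obtain ⟨n, rfl⟩ := exists_sq_eq u
    refine not_conicAvoids_of_params he0 hb0 (by rintro rfl; simp at hu0) hsum he ?_ hu₂ h
    rwa [(artinSchreierRange F).add_mem_cancel_right hse]
  · rcases exists_mem_and_div_not_mem hk hl with ⟨u, hu0, hu₁, hu₂⟩ | hF
    · obtain ⟨n, rfl⟩ := exists_sq_eq u
      refine not_conicAvoids_of_params he0 hb0 (by rintro rfl; simp at hu0) hsum he ?_ hu₂ h
      rwa [(artinSchreierRange F).add_mem_cancel_left hu₁]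
    · have he1 : e = 1 := by
        have := (hF d).resolve_left hd0
        rw [this] at hd
        exact inv_eq_one.mp hd
      subst he1
      have hb : b = s ^ 2 := by grind
      subst hb
      refine not_conicAvoids_of_card_four hF ((hF _).resolve_left ?_) h
      grind

theorem conicAvoids_iff {a b : F} :
    ConicAvoids a b ↔ ∃ d : F, d ≠ 0 ∧ d ≠ 1 ∧
      ((a * (d ^ 2 + d ^ 4) = 1 + d ^ 2 + d ^ 4 ∧ b * (d ^ 2 + d ^ 4) = 1 + d + d ^ 2) ∨
        (a = 1 ∧ b * (d + d ^ 2) = 1)) := by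
  constructor
  · intro h
    have he : (a + b + 1)⁻¹ ∈ artinSchreierRange F := by
      by_contra hP
      exact h.2 (a + b + 1) 0 hP (Or.inl rfl) (by grind)
    obtain ⟨d, hd⟩ := mem_artinSchreierRange.mp he
    have hd0 : d ^ 2 + d ≠ 0 := hd ▸ inv_ne_zero h.1
    have hmul : (a + b + 1) * (d ^ 2 + d) = 1 := by rw [hd, mul_inv_cancel₀ h.1]
    refine ⟨d, by grind, by grind, ?_⟩
    obtain ⟨s, rfl⟩ := exists_sq_eq a
    rcases eq_or_eq_of_conicAvoids h ⟨d, hd0, hd.symm⟩ with hs | hs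
    · right
      grind
    · left
      generalize hsum : s ^ 2 + b + 1 = e at *
      have hb : b = e + e ^ 2 := by grind
      subst hs hb
      constructor <;> grind
  · rintro ⟨d, hd0, hd1, ⟨ha, hb⟩ | ⟨rfl, hb⟩⟩
    · have hD : d + d ^ 2 ≠ 0 := by grind
      have hmul : (d + d ^ 2)⁻¹ * (d + d ^ 2) = 1 := inv_mul_cancel₀ hD
      generalize (d + d ^ 2)⁻¹ = e at hmul
      have h2 : e ^ 2 * (d ^ 2 + d ^ 4) = 1 := by grind
      have ha' : a = 1 + e ^ 2 := by grind
      have hb' : b = e + e ^ 2 := by grind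
      rw [ha', hb']
      exact conicAvoids_of_add_one hmul
    · exact conicAvoids_one hb

end FiniteFieldChar2

theorem cross_difference_eq {K : Type*} [Field K] [CharP K 2] (a b : K) {u u' r r' : K}
    (hu : u * u' = 1) (hr : r * r' = 1) :
    u * (a + b * (r' * u') + (r' * u') ^ 2) * (a + b * (r * u') + (r * u') ^ 2) +
      u' * (a + b * (r * u) + (r * u) ^ 2) * (a + b * (r' * u) + (r' * u) ^ 2) =
    (u + u') * ((u + u') ^ 2 + b * (u + u') * (r + r') + a * (r + r') ^ 2 + (a + b + 1) ^ 2) := by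
  grind

section QuadraticExtension

open FiniteField

variable {F K : Type*} [Field F] [Field K] [Algebra F K] [Fintype F]

local notation "φ" => frobeniusAlgHom F K

theorem frobenius_eq_self_iff {x : K} : φ x = x ↔ ∃ y : F, algebraMap F K y = x := by
  constructor
  · intro hx
    classical
    let S : Finset K := Finset.univ.image (algebraMap F K)
    have hq : 1 < Fintype.card F := Fintype.one_lt_card
    have hS : S.card = Fintype.card F :=
      Finset.card_image_of_injective _ (algebraMap F K).injective
    have hroots : S.val ≤ (Polynomial.X ^ Fintype.card F - Polynomial.X : Polynomial K).roots := by
      refine (Multiset.le_iff_subset S.nodup).mpr fun z hz => ?_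
      obtain ⟨y, -, rfl⟩ := Finset.mem_image.mp hz
      rw [Polynomial.mem_roots (X_pow_card_sub_X_ne_zero K hq)]
      simp [← map_pow, FiniteField.pow_card]
    have hEq := Multiset.eq_of_le_of_card_le hroots <| by
      refine (Polynomial.card_roots' _).trans ?_
      rw [X_pow_card_sub_X_natDegree_eq K hq]
      exact hS.ge
    have hmem : x ∈ (Polynomial.X ^ Fintype.card F - Polynomial.X : Polynomial K).roots := by
      rw [Polynomial.mem_roots (X_pow_card_sub_X_ne_zero K hq)]
      simpa [sub_eq_zero] using hx
    rw [← hEq] at hmem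
    simpa [S] using hmem
  · rintro ⟨y, rfl⟩
    exact (φ).commutes y

variable [Fintype K]

theorem frobenius_frobenius (hK : Fintype.card K = Fintype.card F ^ 2) (x : K) :
    φ (φ x) = x := by
  change (x ^ Fintype.card F) ^ Fintype.card F = x
  rw [← pow_mul, ← sq, ← hK, FiniteField.pow_card]

variable [CharP K 2]

theorem exists_frobenius_eq_mul {s : K} (hs : s * φ s = 1)
    (hK : Fintype.card K = Fintype.card F ^ 2) : ∃ x ≠ 0, φ x = s * x := by
  rcases eq_or_ne s 1 with rfl | h1
  · exact ⟨1, one_ne_zero, by simp⟩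
  · refine ⟨1 + φ s, fun h => h1 ?_, ?_⟩
    · have : φ s = 1 := (CharTwo.add_eq_zero.mp h).symm
      rwa [this, mul_one] at hs
    · rw [map_add, map_one, frobenius_frobenius hK]
      linear_combination -hs


theorem exists_frobenius_eq_add_one (hK : Fintype.card K = Fintype.card F ^ 2) :
    ∃ x : K, φ x = x + 1 := by
  obtain ⟨x, hx⟩ : ∃ x : K, φ x ≠ x := by
    by_contra! h
    have hsurj : Function.Surjective (algebraMap F K) :=
      fun x => frobenius_eq_self_iff.mp (h x)
    have := Fintype.card_le_of_surjective _ hsurj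
    have hq : 1 < Fintype.card F := Fintype.one_lt_card
    nlinarith
  have hd : x + φ x ≠ 0 := fun h => hx (CharTwo.add_eq_zero.mp h).symm
  refine ⟨x / (x + φ x), ?_⟩
  rw [map_div₀, map_add, frobenius_frobenius hK]
  grind

variable [CharP F 2]

theorem exists_norm_one_of_inv_not_mem (hK : Fintype.card K = Fintype.card F ^ 2) {w : F}
    (hw : w⁻¹ ∉ artinSchreierRange F) :
    ∃ u : K, u * φ u = 1 ∧ u ≠ 1 ∧ u + φ u = algebraMap F K w := by
  obtain ⟨z, hz⟩ := exists_frobenius_eq_add_one (F := F) hK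
  have hw0 : w ≠ 0 := by
    rintro rfl
    exact hw (by simp [zero_mem])
  obtain ⟨k, hk⟩ : ∃ k : F, algebraMap F K k = z ^ 2 + z := by
    refine frobenius_eq_self_iff.mp ?_
    rw [map_add, map_pow, hz]
    grind
  have hkP : k ∉ artinSchreierRange F := by
    intro h
    obtain ⟨y, rfl⟩ := mem_artinSchreierRange.mp h
    rw [map_add, map_pow] at hk
    have hfix : φ z = z := by
      refine frobenius_eq_self_iff.mpr ?_
      rcases eq_or_eq_add_one_of_sq_add_eq hk.symm with h | h
      · exact ⟨y, h.symm⟩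
      · exact ⟨y + 1, by rw [h, map_add, map_one]⟩
    simp [hfix] at hz
  have hmem : w⁻¹ ^ 2 + k ∈ artinSchreierRange F := by
    rw [add_mem_artinSchreierRange_iff, sq_mem_artinSchreierRange_iff]
    tauto
  obtain ⟨y, hy⟩ := mem_artinSchreierRange.mp hmem
  have hyK := congrArg (algebraMap F K) hy
  simp only [map_add, map_pow, map_inv₀, hk] at hyK
  have hw0' : algebraMap F K w ≠ 0 := by simpa using hw0
  have hφ : φ (algebraMap F K w * (algebraMap F K y + z)) =
      algebraMap F K w * (algebraMap F K y + z) + algebraMap F K w := by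
    rw [map_mul, map_add, AlgHom.commutes, AlgHom.commutes, hz]
    ring
  refine ⟨algebraMap F K w * (algebraMap F K y + z), ?_, ?_, ?_⟩
  · rw [hφ]
    grind
  · intro h
    rw [h, map_one] at hφ
    exact hw0' (by simpa using hφ)
  · rw [hφ]
    grind

omit [Fintype K] in
theorem inv_not_mem_of_norm_one {w : F} {u : K} (hu : u * φ u = 1) (hu1 : u ≠ 1)
    (huw : u + φ u = algebraMap F K w) : w⁻¹ ∉ artinSchreierRange F := by
  have hfix : φ u ≠ u := by
    intro h
    rw [h] at hu
    exact hu1 (CharTwo.sq_injective (by simpa [sq] using hu))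
  have hw0 : algebraMap F K w ≠ 0 := by
    intro h
    exact hfix (CharTwo.add_eq_zero.mp (huw.trans h)).symm
  intro hP
  obtain ⟨y, hy⟩ := mem_artinSchreierRange.mp hP
  have hyK := congrArg (algebraMap F K) hy
  simp only [map_add, map_pow, map_inv₀] at hyK
  have hq : (u / algebraMap F K w) ^ 2 + u / algebraMap F K w =
      (algebraMap F K y ^ 2) ^ 2 + algebraMap F K y ^ 2 := by
    have h₁ : (algebraMap F K y ^ 2) ^ 2 + algebraMap F K y ^ 2 = (algebraMap F K w)⁻¹ ^ 2 := by
      grind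
    rw [h₁]
    field_simp
    grind
  refine hfix (frobenius_eq_self_iff.mpr ?_)
  rcases eq_or_eq_add_one_of_sq_add_eq hq with h | h
  · exact ⟨y ^ 2 * w, by rw [map_mul, map_pow, ← h, div_mul_cancel₀ _ hw0]⟩
  · refine ⟨(y ^ 2 + 1) * w, ?_⟩
    rw [map_mul, map_add, map_pow, map_one, ← h, div_mul_cancel₀ _ hw0]

/-- The trinomial `ax + bx^q + x^(2q-1)`, as a function on `K`, where `q = |F|`. -/
def trinomialMap (a b : F) (x : K) : K :=
  algebraMap F K a * x + algebraMap F K b * x ^ Fintype.card F + x ^ (2 * Fintype.card F - 1)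

omit [CharP F 2] [CharP K 2] [Fintype K] in
theorem trinomialMap_zero (a b : F) : trinomialMap a b (0 : K) = 0 := by
  have hq : 1 < Fintype.card F := Fintype.one_lt_card
  simp [trinomialMap, show Fintype.card F ≠ 0 by omega, show 2 * Fintype.card F - 1 ≠ 0 by omega]

omit [CharP F 2] [CharP K 2] [Fintype K] in
theorem trinomialMap_algebraMap_mul (a b c : F) (x : K) :
    trinomialMap a b (algebraMap F K c * x) = algebraMap F K c * trinomialMap a b x := by
  have hq : 1 < Fintype.card F := Fintype.one_lt_card
  have h : c ^ (2 * Fintype.card F - 1) = c := by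
    rw [show 2 * Fintype.card F - 1 = Fintype.card F + (Fintype.card F - 1) by omega, pow_add,
      FiniteField.pow_card, ← pow_succ', Nat.sub_add_cancel hq.le, FiniteField.pow_card]
  simp only [trinomialMap, mul_pow, ← map_pow, h, FiniteField.pow_card]
  ring

omit [CharP F 2] [CharP K 2] [Fintype K] in
theorem trinomialMap_eq_of_frobenius_eq (a b : F) {x s : K} (hx : φ x = s * x) :
    trinomialMap a b x = x * (algebraMap F K a + algebraMap F K b * s + s ^ 2) := by
  have hq : 1 < Fintype.card F := Fintype.one_lt_card
  have hx' : x ^ Fintype.card F = s * x := hx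
  rcases eq_or_ne x 0 with rfl | hx0
  · rw [trinomialMap_zero, zero_mul]
  have h : x ^ (2 * Fintype.card F - 1) = s ^ 2 * x := by
    refine mul_right_cancel₀ hx0 ?_
    rw [← pow_succ, Nat.sub_add_cancel (by omega), mul_comm 2, pow_mul, hx']
    ring
  rw [trinomialMap, h, hx']
  ring

theorem conicAvoids_of_injective (hK : Fintype.card K = Fintype.card F ^ 2) {a b : F}
    (hinj : Function.Injective (trinomialMap a b : K → K)) : ConicAvoids a b := by
  have hzero : ∀ x : K, trinomialMap a b x = 0 → x = 0 := fun x hx =>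
    hinj (hx.trans (trinomialMap_zero a b).symm)
  constructor
  · intro h
    refine one_ne_zero (hzero 1 ?_)
    rw [trinomialMap_eq_of_frobenius_eq a b (s := 1) (by simp)]
    simpa using congrArg (algebraMap F K) h
  intro w v hw hv hc
  obtain ⟨u, hu, hu1, huw⟩ := exists_norm_one_of_inv_not_mem hK hw
  obtain ⟨r, hr, hrv⟩ : ∃ r : K, r * φ r = 1 ∧ r + φ r = algebraMap F K v := by
    rcases hv with rfl | hv
    · exact ⟨1, by simp, by simp [CharTwo.add_self_eq_zero]⟩
    · obtain ⟨r, hr, -, hrv⟩ := exists_norm_one_of_inv_not_mem hK hv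
      exact ⟨r, hr, hrv⟩
  have huφ := frobenius_frobenius hK u
  have hrφ := frobenius_frobenius hK r
  have hsφ : φ (r * u) = φ r * φ u := map_mul _ _ _
  have htφ : φ (r * φ u) = φ r * u := by rw [map_mul, huφ]
  obtain ⟨x, hx0, hx⟩ := exists_frobenius_eq_mul (F := F) (s := r * u) (by grind) hK
  obtain ⟨y, hy0, hy⟩ := exists_frobenius_eq_mul (F := F) (s := r * φ u) (by grind) hK
  have hfx := trinomialMap_eq_of_frobenius_eq a b hx
  have hfy := trinomialMap_eq_of_frobenius_eq a b hy
  have hcK := congrArg (algebraMap F K) hc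
  simp only [map_add, map_mul, map_pow, map_one, map_zero, ← huw, ← hrv] at hcK
  have hφ₁ : φ (trinomialMap a b x) = r * u * x *
      (algebraMap F K a + algebraMap F K b * (φ r * φ u) + (φ r * φ u) ^ 2) := by
    simp only [hfx, map_add, map_mul, map_pow, AlgHom.commutes, hx]
  have hφ₂ : φ (trinomialMap a b y) = r * φ u * y *
      (algebraMap F K a + algebraMap F K b * (φ r * u) + (φ r * u) ^ 2) := by
    simp only [hfy, map_add, map_mul, map_pow, AlgHom.commutes, hy, huφ]
  have hfy0 : trinomialMap a b y ≠ 0 := fun h => hy0 (hzero y h)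
  have hfix : φ (trinomialMap a b x / trinomialMap a b y) =
      trinomialMap a b x / trinomialMap a b y := by
    have hfy0' : φ (trinomialMap a b y) ≠ 0 := by simpa using hfy0
    rw [map_div₀, div_eq_div_iff hfy0' hfy0, hφ₁, hφ₂, hfx, hfy]
    have key := cross_difference_eq (algebraMap F K a) (algebraMap F K b) hu hr
    rw [hcK, mul_zero, CharTwo.add_eq_zero] at key
    linear_combination x * y * r * key
  obtain ⟨l, hl⟩ := frobenius_eq_self_iff.mp hfix
  have hxy : x = algebraMap F K l * y := by
    refine hinj ?_
    rw [trinomialMap_algebraMap_mul, hl, div_mul_cancel₀ _ hfy0]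
  have hφxy := congrArg φ hxy
  rw [map_mul, AlgHom.commutes, hx, hy] at hφxy
  have hr0 : r ≠ 0 := left_ne_zero_of_mul_eq_one hr
  have huu : u = φ u := by
    have : (u - φ u) * (r * x) = 0 := by
      linear_combination hφxy - r * φ u * hxy
    rcases mul_eq_zero.mp this with h | h
    · exact sub_eq_zero.mp h
    · exact absurd h (mul_ne_zero hr0 hx0)
  rw [← huu] at hu
  exact hu1 (CharTwo.sq_injective (by simpa [sq] using hu))

theorem injective_of_conicAvoids (hK : Fintype.card K = Fintype.card F ^ 2) {a b : F}
    (h : ConicAvoids a b) : Function.Injective (trinomialMap a b : K → K) := by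
  obtain ⟨he, h⟩ := h
  have heK := (map_ne_zero (algebraMap F K)).mpr he
  rw [map_add, map_add, map_one] at heK
  have hdef : ∀ x : K, x ≠ 0 → φ x = φ x / x * x ∧ φ x / x * φ (φ x / x) = 1 := by
    intro x hx
    have : φ x ≠ 0 := by simpa using hx
    refine ⟨(div_mul_cancel₀ _ hx).symm, ?_⟩
    rw [map_div₀, frobenius_frobenius hK]
    field_simp
  have hzero : ∀ x : K, trinomialMap a b x = 0 → x = 0 := by
    intro x hfx
    by_contra hx0
    obtain ⟨hx, hs⟩ := hdef x hx0
    generalize φ x / x = s at hx hs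
    rw [trinomialMap_eq_of_frobenius_eq a b hx] at hfx
    have hroot := (mul_eq_zero.mp hfx).resolve_left hx0
    have hconj := congrArg φ hroot
    simp only [map_add, map_mul, map_pow, AlgHom.commutes, map_zero] at hconj
    have hs1 : s ≠ 1 := by
      rintro rfl
      exact heK (by simpa using hroot)
    have hprod : (algebraMap F K a + 1) * (s + 1) ^ 2 = 0 := by grind
    have ha : a = 1 := by
      have hs1' : s + 1 ≠ 0 := fun h => hs1 (CharTwo.add_eq_zero.mp h)
      have := (mul_eq_zero.mp hprod).resolve_right (pow_ne_zero 2 hs1')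
      exact (algebraMap F K).injective (by rw [map_one]; exact CharTwo.add_eq_zero.mp this)
    subst ha
    have hsb : s + φ s = algebraMap F K b := by
      rw [map_one] at hroot
      grind
    refine h b 0 (inv_not_mem_of_norm_one hs hs1 hsb) (Or.inl rfl) ?_
    grind
  intro x y hxy
  rcases eq_or_ne x 0 with rfl | hx0
  · rw [trinomialMap_zero] at hxy
    exact (hzero y hxy.symm).symm
  rcases eq_or_ne y 0 with rfl | hy0
  · rw [trinomialMap_zero] at hxy
    exact hzero x hxy
  have hfx0 : trinomialMap a b x ≠ 0 := fun h => hx0 (hzero x h)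
  obtain ⟨hx, hs⟩ := hdef x hx0
  obtain ⟨hy, ht⟩ := hdef y hy0
  by_cases hst : φ x / x = φ y / y
  · obtain ⟨l, hl⟩ : ∃ l : F, algebraMap F K l = x / y := by
      refine frobenius_eq_self_iff.mp ?_
      have : φ y ≠ 0 := by simpa using hy0
      rw [map_div₀]
      field_simp at hst ⊢
      linear_combination hst
    have hxl : x = algebraMap F K l * y := by rw [hl, div_mul_cancel₀ _ hy0]
    rw [hxl, trinomialMap_algebraMap_mul] at hxy
    have hl1 : algebraMap F K l = 1 := by
      refine mul_right_cancel₀ (b := trinomialMap a b y) ?_ (by rw [hxy, one_mul])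
      exact fun h => hy0 (hzero y h)
    rw [hxl, hl1, one_mul]
  · exfalso
    generalize φ x / x = s at *
    generalize φ y / y = t at *
    have hfx := trinomialMap_eq_of_frobenius_eq a b hx
    have hfy := trinomialMap_eq_of_frobenius_eq a b hy
    have hφ := congrArg φ hxy
    simp only [hfx, hfy, map_add, map_mul, map_pow, AlgHom.commutes, hx, hy] at hφ
    rw [hfx, hfy] at hxy
    rw [hfx] at hfx0
    have hs0 : s ≠ 0 := left_ne_zero_of_mul_eq_one hs
    obtain ⟨r, hr⟩ := exists_sq_eq (s * t)
    have hr1 : r * φ r = 1 := CharTwo.sq_injective (by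
      change (r * φ r) ^ 2 = 1 ^ 2
      rw [mul_pow, ← map_pow, hr, map_mul]
      linear_combination t * φ t * hs + ht)
    have hr0 : r ≠ 0 := left_ne_zero_of_mul_eq_one hr1
    have hu1 : s * φ r * φ (s * φ r) = 1 := by
      rw [map_mul, frobenius_frobenius hK]
      linear_combination r * φ r * hs + hr1
    have hune : s * φ r ≠ 1 := by
      intro hu
      have : s = r := by linear_combination r * hu - s * hr1
      rw [this, sq] at hr
      exact hst (this.trans (mul_left_cancel₀ hr0 hr))
    obtain ⟨w, hw⟩ : ∃ w : F, algebraMap F K w = s * φ r + φ (s * φ r) := by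
      refine frobenius_eq_self_iff.mp ?_
      rw [map_add, frobenius_frobenius hK, add_comm]
    obtain ⟨v, hv⟩ : ∃ v : F, algebraMap F K v = r + φ r := by
      refine frobenius_eq_self_iff.mp ?_
      rw [map_add, frobenius_frobenius hK, add_comm]
    refine h w v (inv_not_mem_of_norm_one hu1 hune hw.symm) ?_ ?_
    · rcases eq_or_ne r 1 with rfl | hr1'
      · left
        refine (algebraMap F K).injective ?_
        rw [hv, map_one, map_zero, CharTwo.add_self_eq_zero]
      · exact Or.inr (inv_not_mem_of_norm_one hr1 hr1' hv.symm)
    · refine (algebraMap F K).injective ?_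
      simp only [map_add, map_mul, map_pow, map_one, map_zero]
      rw [hw, hv]
      have key := cross_difference_eq (algebraMap F K a) (algebraMap F K b) hu1 hr1
      have hs' : s = r * (s * φ r) := by linear_combination -s * hr1
      have ht' : t = r * φ (s * φ r) := by
        rw [map_mul, frobenius_frobenius hK]
        linear_combination -φ s * hr - t * hs
      have hsφ : φ s = φ r * φ (s * φ r) := by
        rw [map_mul, frobenius_frobenius hK]
        linear_combination -φ s * hr1
      have htφ : φ t = φ r * (s * φ r) := by
        rw [ht', map_mul, frobenius_frobenius hK]
      have hsum : s * φ r + φ (s * φ r) ≠ 0 := by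
        intro h0
        have := CharTwo.add_eq_zero.mp h0
        exact hst (by rw [hs', ht', ← this])
      rw [hsφ, htφ] at hφ
      rw [← mul_right_inj' hsum, mul_zero, ← key]
      have hrxy : r * x * y ≠ 0 := mul_ne_zero (mul_ne_zero hr0 hx0) hy0
      rw [← mul_right_inj' hrxy, mul_zero]
      clear hfx hfy hzero hdef h key hsφ htφ hw hv hsum hx hy hs ht hu1 hune hr hfx0
      generalize φ (s * φ r) = u' at *
      generalize s * φ r = u at *
      rw [hs', ht'] at hφ hxy
      generalize φ r = r' at *
      generalize algebraMap F K a = a at *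
      generalize algebraMap F K b = b at *
      have h2 : (2 : K) = 0 := CharTwo.two_eq_zero
      linear_combination y * (a + b * (r * u') + (r * u') ^ 2) * hφ +
        r * u' * y * (a + b * (r' * u) + (r' * u) ^ 2) * hxy +
        r * u' * y * (a + b * (r' * u) + (r' * u) ^ 2) * y * (a + b * (r * u') + (r * u') ^ 2) * h2

end QuadraticExtension

section LinearCase

open FiniteField

theorem injective_linear_iff {F K : Type*} [Field F] [Field K] [Algebra F K] [Fintype F]
    [Fintype K] [CharP F 2] [CharP K 2] (hK : Fintype.card K = Fintype.card F ^ 2) (a b : F) :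
    Function.Injective
      (fun x : K => algebraMap F K a * x + algebraMap F K b * x ^ Fintype.card F) ↔ a ≠ b := by
  have hadd : ∀ x y : K, (x + y) ^ Fintype.card F = x ^ Fintype.card F + y ^ Fintype.card F :=
    map_add (frobeniusAlgHom F K)
  constructor
  · rintro hinj rfl
    have hq : Fintype.card F ≠ 0 := Fintype.card_ne_zero
    refine one_ne_zero (α := K) (hinj ?_)
    simp [hq, CharTwo.add_self_eq_zero]
  · intro hab x y hxy
    rw [← CharTwo.add_eq_zero]
    have h : algebraMap F K a * (x + y) = algebraMap F K b * (x + y) ^ Fintype.card F := by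
      rw [hadd]
      grind
    have hφ := congrArg (frobeniusAlgHom F K) h
    rw [map_mul, map_mul, AlgHom.commutes, AlgHom.commutes,
      show (x + y) ^ Fintype.card F = frobeniusAlgHom F K (x + y) from rfl,
      frobenius_frobenius hK] at hφ
    change _ * (x + y) ^ Fintype.card F = _ at hφ
    have hne : algebraMap F K a + algebraMap F K b ≠ 0 := by
      rw [← map_add]
      simpa [CharTwo.add_eq_zero] using hab
    have : (algebraMap F K a + algebraMap F K b) ^ 2 * (x + y) = 0 := by grind
    exact (mul_eq_zero.mp this).resolve_left (pow_ne_zero 2 hne)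

end LinearCase


/-- For `q` an even prime power and `(a, b, c) ∈ F_q³ \ {(0,0,0)}`, the polynomial
`a·x + b·x^q + c·x^(2q−1)` is a permutation polynomial of `F_{q²}` iff `(a, b, c)`
is a nonzero `F_q`-scalar multiple of `(1+d²+d⁴, 1+d+d², d²+d⁴)` for some
`d ∈ F_q \ F_2`, of `(d+d², 1, d+d²)` for some `d ∈ F_q \ F_2`, of `(d, 1, 0)` for
some `d ≠ 1`, or of `(1, 0, 0)`. -/
theorem trinomial_pp_even_char_projective_classification
    (q : ℕ)
    (F K : Type*) [Field F] [Field K] [Algebra F K]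
    [Fintype F] [Fintype K] [CharP F 2]
    (hF : Fintype.card F = q) (hK : Fintype.card K = q ^ 2)
    (a b c : F) (habc : (a, b, c) ≠ (0, 0, 0)) :
    Function.Bijective (fun x : K =>
        algebraMap F K a * x + algebraMap F K b * x ^ q +
          algebraMap F K c * x ^ (2 * q - 1)) ↔
      ∃ t : F, t ≠ 0 ∧
        ((∃ d : F, d ≠ 0 ∧ d ≠ 1 ∧
            a = t * (1 + d ^ 2 + d ^ 4) ∧ b = t * (1 + d + d ^ 2) ∧
            c = t * (d ^ 2 + d ^ 4)) ∨
         (∃ d : F, d ≠ 0 ∧ d ≠ 1 ∧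
            a = t * (d + d ^ 2) ∧ b = t ∧ c = t * (d + d ^ 2)) ∨
         (∃ d : F, d ≠ 1 ∧ a = t * d ∧ b = t ∧ c = 0) ∨
         (a = t ∧ b = 0 ∧ c = 0)) := by
  have : CharP K 2 := charP_of_injective_algebraMap (algebraMap F K).injective 2
  subst hF
  rw [← Finite.injective_iff_bijective]
  rcases eq_or_ne c 0 with rfl | hc
  · have hlin := injective_linear_iff hK a b
    simp only [map_zero, zero_mul, add_zero]
    rw [hlin]
    constructor
    · intro hab
      rcases eq_or_ne b 0 with rfl | hb
      · exact ⟨a, hab, by simp⟩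
      · refine ⟨b, hb, Or.inr (Or.inr (Or.inl ⟨a / b, ?_, ?_, rfl, trivial⟩))⟩
        · rwa [Ne, div_eq_one_iff_eq hb]
        · rw [mul_div_cancel₀ _ hb]
    · rintro ⟨t, ht, ⟨d, hd0, hd1, -, -, hc⟩ | ⟨d, hd0, hd1, -, -, hc⟩ | ⟨d, hd, rfl, rfl, -⟩ |
        ⟨rfl, rfl, -⟩⟩
      · grind
      · grind
      · simpa [ht] using hd
      · exact ht
  · have hcK : algebraMap F K c ≠ 0 := by simpa using hc
    have hscale : (fun x : K => algebraMap F K a * x + algebraMap F K b * x ^ Fintype.card F +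
        algebraMap F K c * x ^ (2 * Fintype.card F - 1)) =
        (algebraMap F K c * ·) ∘ trinomialMap (a / c) (b / c) := by
      funext x
      simp only [Function.comp_apply, trinomialMap, map_div₀]
      field_simp
    rw [hscale, (mul_right_injective₀ hcK).of_comp_iff]
    have hiff : Function.Injective (trinomialMap (a / c) (b / c) : K → K) ↔
        ConicAvoids (a / c) (b / c) :=
      ⟨conicAvoids_of_injective hK, injective_of_conicAvoids hK⟩
    rw [hiff, conicAvoids_iff]
    constructor
    · rintro ⟨d, hd0, hd1, ⟨ha, hb⟩ | ⟨ha, hb⟩⟩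
      · have hD : d ^ 2 + d ^ 4 ≠ 0 := by grind
        refine ⟨c / (d ^ 2 + d ^ 4), div_ne_zero hc hD, Or.inl ⟨d, hd0, hd1, ?_, ?_, ?_⟩⟩ <;> grind
      · have hD : d + d ^ 2 ≠ 0 := by grind
        refine ⟨b, ?_, Or.inr (Or.inl ⟨d, hd0, hd1, ?_, rfl, ?_⟩)⟩
        · rintro rfl
          simp at hb
        · rw [(div_eq_one_iff_eq hc).mp ha]
          grind
        · grind
    · rintro ⟨t, ht, ⟨d, hd0, hd1, rfl, rfl, rfl⟩ | ⟨d, hd0, hd1, rfl, rfl, rfl⟩ |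
        ⟨d, -, -, -, hc0⟩ | ⟨-, -, hc0⟩⟩
      · refine ⟨d, hd0, hd1, Or.inl ⟨?_, ?_⟩⟩ <;> grind
      · refine ⟨d, hd0, hd1, Or.inr ⟨?_, ?_⟩⟩ <;> grind
      · exact absurd hc0 hc
      · exact absurd hc0 hc
end

section
/- Let q be an odd prime power of characteristic p and let n = q^α − 2 (i.e., n = q^α − q⁰ − 1) with 2 < α < 2p. Write α = a₀ + 2a₁ with a₀ ∈ {0,1} and a₁ ∈ ℕ. Then g_{n,q}(x) = a₁·x^(q−2) + (a₀ + a₁ − 1)·x^(q²−2) for all x ∈ F_{q²}, and g_{n,q} is not a permutation polynomial of F_{q²}. -/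
open Polynomial

theorem FiniteField.sum_pow_of_pos (F : Type*) [Field F] [Fintype F] (m : ℕ) (hm : 0 < m) :
    ∑ c : F, c ^ m = if Fintype.card F - 1 ∣ m then -1 else 0 := by
  classical
  rw [← FiniteField.sum_pow_units F m, ← Finset.sum_filter_add_sum_filter_not _ (fun c : F => c ≠ 0)]
  have h0 : ∑ c : F with ¬ c ≠ 0, c ^ m = 0 :=
    Finset.sum_eq_zero fun c hc => by
      simp only [ne_eq, not_not, Finset.mem_filter, Finset.mem_univ, true_and] at hc
      rw [hc, zero_pow hm.ne']
  rw [h0, add_zero]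
  symm
  refine Finset.sum_bij (fun u _ => (u : F)) (by simp) (fun u _ v _ h => Units.ext h)
    (fun c hc => ⟨Units.mk0 c (by simpa using hc), by simp, rfl⟩) (by simp)

theorem FiniteField.sum_add_algebraMap_pow (F : Type*) {L : Type*} [Field F] [Fintype F] [Field L]
    [Algebra F L] (y : L) (j : ℕ) (hj : j ≤ Fintype.card F - 1) :
    ∑ c : F, (y + algebraMap F L c) ^ j = if j = Fintype.card F - 1 then -1 else 0 := by
  have hq : 1 < Fintype.card F := Fintype.one_lt_card
  simp_rw [add_pow]
  rw [Finset.sum_comm]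
  have key : ∀ i ∈ Finset.range (j + 1),
      ∑ c : F, y ^ i * algebraMap F L c ^ (j - i) * (j.choose i : L) =
        if i = 0 then (if j = Fintype.card F - 1 then -1 else 0) else 0 := by
    intro i hi
    rw [← Finset.sum_mul, ← Finset.mul_sum]
    simp_rw [← map_pow]
    rw [← map_sum]
    split_ifs with h0 h1
    · subst h0
      rw [Nat.sub_zero, FiniteField.sum_pow_of_pos F j (by omega), if_pos (by rw [h1])]
      simp
    · rw [FiniteField.sum_pow_lt_card_sub_one F _ (by omega)]
      simp
    · rw [FiniteField.sum_pow_lt_card_sub_one F _ (by simp at hi; omega)]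
      simp
  rw [Finset.sum_congr rfl key]
  simp

theorem pow_card_pow_eq_add {F L : Type*} [Field F] [Fintype F] [Field L] [Algebra F L]
    (x y : L) (hy : y ^ Fintype.card F = y + x)
    (hx : x ^ (Fintype.card F ^ 2) = x) (a₀ a₁ : ℕ) (ha₀ : a₀ ≤ 1) :
    y ^ (Fintype.card F ^ (a₀ + 2 * a₁)) = y + (a₀ * x + a₁ * (x + x ^ Fintype.card F)) := by
  set q := Fintype.card F
  have hadd : ∀ u v : L, (u + v) ^ q = u ^ q + v ^ q :=
    fun u v => map_add (FiniteField.frobeniusAlgHom F L) u v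
  have hcast : ∀ k : ℕ, (k : L) ^ q = k := fun k => map_natCast (FiniteField.frobeniusAlgHom F L) k
  have hxq : (x ^ q) ^ q = x := by rw [← pow_mul, ← sq, hx]
  have heven : y ^ (q ^ (2 * a₁)) = y + a₁ * (x + x ^ q) := by
    induction a₁ with
    | zero => simp
    | succ k ih =>
      rw [show q ^ (2 * (k + 1)) = q ^ (2 * k) * q * q by ring, pow_mul, pow_mul, ih]
      simp only [hadd, mul_pow, hcast, hy, hxq]
      push_cast
      ring
  rcases Nat.le_one_iff_eq_zero_or_eq_one.1 ha₀ with rfl | rfl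
  · simpa using heven
  · rw [add_comm, pow_succ, pow_mul, heven]
    simp only [hadd, mul_pow, hcast, hy, hxq]
    push_cast
    ring

theorem sq_mul_sum_add_algebraMap_pow {F L : Type*} [Field F] [Fintype F] [Field L] [Algebra F L]
    (h2 : 2 < Fintype.card F) (x y S : L) (hy : y ^ Fintype.card F = y + x) (α n : ℕ)
    (hn : n + 2 = Fintype.card F ^ α) (hS : y ^ (Fintype.card F ^ α) = y + S) :
    x ^ 2 * ∑ c : F, (y + algebraMap F L c) ^ n = S - x := by
  have hterm : ∀ c : F, x ^ 2 * (y + algebraMap F L c) ^ n =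
      x * (y + algebraMap F L c) ^ (Fintype.card F - 1) - x +
        S * (x * (y + algebraMap F L c) ^ (Fintype.card F - 2)
          - (y + algebraMap F L c) ^ (Fintype.card F - 1) + 1) := by
    intro c
    have h1 : (y + algebraMap F L c) ^ Fintype.card F = y + algebraMap F L c + x := by
      have := map_add (FiniteField.frobeniusAlgHom F L) y (algebraMap F L c)
      rw [AlgHom.commutes] at this
      simp only [FiniteField.coe_frobeniusAlgHom] at this
      rw [this, hy]
      ring
    have h3 : (y + algebraMap F L c) ^ (n + 2) = y + algebraMap F L c + S := by
      have := map_add (FiniteField.frobeniusAlgHom F L ^ α) y (algebraMap F L c)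
      rw [AlgHom.commutes] at this
      simp only [AlgHom.coe_pow, FiniteField.coe_frobeniusAlgHom, pow_iterate] at this
      rw [hn, this, hS]
      ring
    generalize y + algebraMap F L c = z at h1 h3 ⊢
    obtain ⟨k, hk⟩ : ∃ k, Fintype.card F = k + 2 := ⟨_, (Nat.sub_add_cancel h2.le).symm⟩
    rw [hk] at h1 ⊢
    simp only [Nat.add_sub_cancel, show k + 2 - 1 = k + 1 by omega]
    have hx : x = z ^ (k + 2) - z := by rw [h1]; ring
    have e : x ^ 2 * z ^ n = (z ^ (k + 1) - 1) ^ 2 * z ^ (n + 2) := by rw [hx]; ring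
    have e2 : (z ^ (k + 1)) ^ 2 = z ^ k * (z + x) := by rw [← h1]; ring
    have e3 : (z ^ (k + 1) - 1) ^ 2 = x * z ^ k - z ^ (k + 1) + 1 := by
      linear_combination e2
    rw [e, h3, e3]
    linear_combination -h1
  rw [Finset.mul_sum, Finset.sum_congr rfl fun c _ => hterm c]
  have hc : (Fintype.card F : L) = 0 := by
    rw [← map_natCast (algebraMap F L), FiniteField.cast_card_eq_zero, map_zero]
  simp only [Finset.sum_add_distrib, Finset.sum_sub_distrib, ← Finset.mul_sum,
    FiniteField.sum_add_algebraMap_pow F y _ le_rfl,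
    FiniteField.sum_add_algebraMap_pow F y (Fintype.card F - 2) (by omega),
    if_neg (show Fintype.card F - 2 ≠ Fintype.card F - 1 by omega),
    Finset.sum_const, Finset.card_univ, nsmul_eq_mul, hc, if_true]
  ring

theorem sum_binomial_pow {K : Type*} [Field K] [Fintype K] (q : ℕ) (hq : 2 < q)
    (hK : Fintype.card K = q ^ 2) (a b : K) :
    ∑ x : K, (a * x ^ (q - 2) + b * x ^ (q ^ 2 - 2)) ^ (q - 1) = a * b ^ (q - 2) := by
  have hqK : (q : K) = 0 := by
    have := FiniteField.cast_card_eq_zero K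
    rw [hK] at this
    push_cast at this
    exact pow_eq_zero_iff (two_ne_zero) |>.1 this
  obtain ⟨k, rfl⟩ : ∃ k, q = k + 3 := ⟨q - 3, by omega⟩
  have e1 : k + 3 - 2 = k + 1 := by omega
  have e2 : k + 3 - 1 = k + 2 := by omega
  have e3 : (k + 3) ^ 2 - 2 = k ^ 2 + 6 * k + 7 := by
    rw [show (k + 3) ^ 2 = k ^ 2 + 6 * k + 7 + 2 by ring, Nat.add_sub_cancel]
  have e4 : Fintype.card K - 1 = (k + 2) * (k + 4) := by
    rw [hK, show (k + 3) ^ 2 = (k + 2) * (k + 4) + 1 by ring, Nat.add_sub_cancel]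
  rw [e1, e2, e3]
  simp_rw [add_pow, mul_pow]
  rw [Finset.sum_comm]
  have key : ∀ i ∈ Finset.range (k + 2 + 1),
      ∑ x : K, a ^ i * (x ^ (k + 1)) ^ i *
          (b ^ (k + 2 - i) * (x ^ (k ^ 2 + 6 * k + 7)) ^ (k + 2 - i)) * ((k + 2).choose i : K) =
        if i = 1 then a * b ^ (k + 1) else 0 := by
    intro i hi
    obtain ⟨j, hj⟩ : ∃ j, k + 2 = i + j := ⟨k + 2 - i, by simp at hi; omega⟩
    have hj' : k + 2 - i = j := by omega
    set m := (k + 1) * i + (k ^ 2 + 6 * k + 7) * j with hm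
    have hm0 : 0 < m := by
      rcases Nat.eq_zero_or_pos i with h | h
      · have : 0 < j := by omega
        positivity
      · positivity
    have hsum : ∑ x : K, a ^ i * (x ^ (k + 1)) ^ i *
          (b ^ (k + 2 - i) * (x ^ (k ^ 2 + 6 * k + 7)) ^ (k + 2 - i)) * ((k + 2).choose i : K) =
        (a ^ i * b ^ j * ((k + 2).choose i : K)) * ∑ x : K, x ^ m := by
      rw [Finset.mul_sum, hj']
      refine Finset.sum_congr rfl fun x _ => ?_
      rw [hm, pow_add x ((k + 1) * i), pow_mul x (k + 1), pow_mul x (k ^ 2 + 6 * k + 7)]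
      ring
    have hdvd : (k + 2) * (k + 4) ∣ m ↔ i = 1 := by
      have hmz : m + (k + 2) = (k + 2) * (i + (k + 4) * j) := by
        rw [hm]
        have : k + 2 = i + j := hj
        nlinarith
      constructor
      · rintro ⟨t, ht⟩
        rw [ht] at hmz
        have h5 : (k + 4) * t + 1 = i + (k + 4) * j :=
          Nat.eq_of_mul_eq_mul_left (show 0 < k + 2 by omega) (by rw [← hmz]; ring)
        have h6 := congrArg (· % (k + 4)) h5
        simpa [Nat.add_mod, Nat.mod_eq_of_lt (show i < k + 4 by omega)] using h6.symm
      · rintro rfl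
        refine ⟨j, ?_⟩
        have : m + (k + 2) = (k + 2) * (k + 4) * j + (k + 2) := by rw [hmz]; ring
        exact Nat.add_right_cancel this
    rw [hsum, FiniteField.sum_pow_of_pos K m hm0, e4]
    simp only [hdvd]
    split_ifs with h
    · subst h
      have h7 : j = k + 1 := by omega
      have h8 : (k : K) = -3 := by
        push_cast at hqK
        linear_combination hqK
      rw [h7, Nat.choose_one_right]
      push_cast
      rw [h8]
      ring
    · simp
  rw [Finset.sum_congr rfl key]
  simp

/-- Let `q` be an odd prime power of characteristic `p` and `n = q^α − 2`
(`= q^α − q⁰ − 1`) with `2 < α < 2p`; write `α = a₀ + 2a₁`, `a₀ ∈ {0,1}`. Let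
`g = g_{n,q}` be the polynomial with `∑_{c ∈ F_q} (X + c)^n = g(X^q − X)`. Then
`g(x) = a₁·x^(q−2) + (a₀ + a₁ − 1)·x^(q²−2)` for all `x ∈ F_{q²}`, and `g` is not
a permutation polynomial of `F_{q²}`. -/
theorem g_nq_beta_zero_not_pp
    (p q : ℕ) [Fact p.Prime] (hp : Odd p)
    (F K : Type*) [Field F] [Field K] [Algebra F K]
    [Fintype F] [Fintype K] [CharP F p]
    (hF : Fintype.card F = q) (hK : Fintype.card K = q ^ 2)
    (α a₀ a₁ : ℕ) (hα2 : 2 < α) (hα : α < 2 * p)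
    (ha₀ : a₀ ≤ 1) (hαa : α = a₀ + 2 * a₁)
    (n : ℕ) (hn : n = q ^ α - 2)
    (g : F[X])
    (hg : ∑ c : F, (X + C c) ^ n = g.comp (X ^ q - X)) :
    (∀ x : K, Polynomial.aeval x g =
        (a₁ : K) * x ^ (q - 2) + ((a₀ : K) + (a₁ : K) - 1) * x ^ (q ^ 2 - 2)) ∧
    ¬ Function.Bijective (fun x : K => Polynomial.aeval x g) := by
  have hq : 2 < q := by
    have hpq : p ∣ q := by
      rw [← hF, ← CharP.cast_eq_zero_iff F p]
      exact FiniteField.cast_card_eq_zero F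
    have h1 := Nat.le_of_dvd (by rw [← hF]; exact Fintype.card_pos) hpq
    have h2 := (Fact.out : p.Prime).two_le
    have h3 : p ≠ 2 := by rintro rfl; exact absurd hp (by decide)
    omega
  have hn2 : n + 2 = q ^ α := by
    have : q ≤ q ^ α := Nat.le_self_pow (by omega) q
    omega
  have hn0 : 0 < n := by
    have : q ≤ q ^ α := Nat.le_self_pow (by omega) q
    omega
  have formula : ∀ x : K, Polynomial.aeval x g =
      (a₁ : K) * x ^ (q - 2) + ((a₀ : K) + (a₁ : K) - 1) * x ^ (q ^ 2 - 2) := by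
    intro x
    have hq2 : q ^ 2 - 2 + 2 = q ^ 2 := Nat.sub_add_cancel (by nlinarith)
    have hxq : x ^ (q ^ 2) = x := by rw [← hK]; exact FiniteField.pow_card x
    by_cases hx : x = 0
    · subst hx
      have h := congrArg (Polynomial.aeval (0 : K)) hg
      rw [aeval_comp] at h
      simp only [map_sum, map_pow, map_add, map_sub, aeval_X, aeval_C, zero_add, sub_zero,
        zero_pow (show q ≠ 0 by omega)] at h
      have hq3 : q ^ 2 - 2 ≠ 0 := by
        have : 2 * 2 < q ^ 2 := by nlinarith
        omega
      rw [← h, zero_pow (show q - 2 ≠ 0 by omega), zero_pow hq3]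
      simp only [← map_pow]
      rw [← map_sum, FiniteField.sum_pow_of_pos F n hn0, if_neg, map_zero]
      · ring
      · intro hd
        rw [hF] at hd
        have h1 : q - 1 ∣ q ^ α - 1 := by simpa using Nat.sub_dvd_pow_sub_pow q 1 α
        have h2 : q ^ α - 1 = n + 1 := by omega
        rw [h2, Nat.dvd_add_right hd] at h1
        have := Nat.le_of_dvd one_pos h1
        omega
    · let L := AlgebraicClosure K
      obtain ⟨y, hy⟩ : ∃ y : L, y ^ q - y = algebraMap K L x := by
        have hdeg : (X ^ q - (X + C (algebraMap K L x)) : L[X]).degree ≠ 0 := by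
          have h1 : (X + C (algebraMap K L x) : L[X]).degree < (X ^ q : L[X]).degree := by
            rw [degree_X_add_C, degree_X_pow]
            exact_mod_cast (by omega : 1 < q)
          rw [degree_sub_eq_left_of_degree_lt h1, degree_X_pow]
          exact_mod_cast (by omega : q ≠ 0)
        obtain ⟨y, hy⟩ := IsAlgClosed.exists_root _ hdeg
        refine ⟨y, ?_⟩
        simp only [IsRoot.def, eval_sub, eval_pow, eval_X, eval_add, eval_C] at hy
        linear_combination hy
      have hy' : y ^ Fintype.card F = y + algebraMap K L x := by
        rw [hF, ← hy]; ring
      have hx2 : algebraMap K L x ^ (Fintype.card F ^ 2) = algebraMap K L x := by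
        rw [hF, ← map_pow, hxq]
      have hS := pow_card_pow_eq_add (F := F) _ y hy' hx2 a₀ a₁ ha₀
      rw [← hαa] at hS
      have key := sq_mul_sum_add_algebraMap_pow (F := F) (by omega) _ y _ hy' α n
        (by rw [hF, hn2]) hS
      have h := congrArg (Polynomial.aeval y) hg
      rw [aeval_comp] at h
      simp only [map_sum, map_pow, map_add, map_sub, aeval_X, aeval_C, hy] at h
      rw [h, aeval_algebraMap_apply, hF] at key
      have key' : x ^ 2 * aeval x g = a₀ * x + a₁ * (x + x ^ q) - x := by
        apply (algebraMap K L).injective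
        simpa using key
      apply mul_left_cancel₀ (pow_ne_zero 2 hx)
      have e1 : x ^ 2 * x ^ (q - 2) = x ^ q := by rw [← pow_add]; congr 1; omega
      have e2 : x ^ 2 * x ^ (q ^ 2 - 2) = x := by rw [← pow_add, add_comm, hq2, hxq]
      rw [key']
      linear_combination (-(a₁ : K)) * e1 - ((a₀ : K) + a₁ - 1) * e2
  refine ⟨formula, fun hbij => ?_⟩
  have : CharP K p := charP_of_injective_algebraMap (algebraMap F K).injective p
  have hsum := sum_binomial_pow q hq hK (a₁ : K) ((a₀ : K) + (a₁ : K) - 1)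
  have hzero : ∑ x : K, (aeval x g) ^ (q - 1) = 0 := by
    rw [hbij.sum_comp (fun y : K => y ^ (q - 1))]
    refine FiniteField.sum_pow_lt_card_sub_one K _ ?_
    rw [hK]
    have : q < q ^ 2 := by nlinarith
    omega
  simp only [formula] at hzero
  rw [hzero] at hsum
  have hne : ∀ m : ℕ, 0 < m → m < p → (m : K) ≠ 0 := by
    intro m h1 h2 h
    rw [CharP.cast_eq_zero_iff K p] at h
    exact absurd (Nat.le_of_dvd h1 h) (by omega)
  have hb : (a₀ : K) + (a₁ : K) - 1 ≠ 0 := by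
    have := hne (a₀ + a₁ - 1) (by omega) (by omega)
    rw [Nat.cast_sub (by omega)] at this
    simpa using this
  exact mul_ne_zero (hne a₁ (by omega) (by omega)) (pow_ne_zero _ hb) hsum.symm
end
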